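/- Let 𝒳 and 𝒴 be countably generated LFCM spaces and C_X, C_Y coarse modules over them (not assumed faithful). Suppose U : H_{C_X} → H_{C_Y} is a unitary such that Ad_U restricts to a *-isomorphism between the algebras of approximable operators on C_X and on C_Y. Then for any δ ∈ (0,1), there exist sufficiently large entourages F ∈ 𝓔^Y and E ∈ 𝓔^X such that the approximate relation f^U_{δ,F,E}, viewed as a relation from dom₁(C_X) to dom₁(C_Y) (each equipped with the subspace coarse structure), is a coarse equivalence, i.e. a coarsely surjective, densely defined partial coarse embedding, with coarse inverse f^{U*}_{δ,E,F}. -/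

import Mathlib

noncomputable section

open scoped ENNReal

/-! ## Relations -/

/-- Composition of relations: for `R ⊆ Z × Y` and `S ⊆ Y × X`,
`RelComp R S = {(z,x) | ∃ y, (z,y) ∈ R ∧ (y,x) ∈ S}`. -/
def RelComp {X Y Z : Type} (R : Set (Z × Y)) (S : Set (Y × X)) : Set (Z × X) :=
  {p | ∃ y, (p.1, y) ∈ R ∧ (y, p.2) ∈ S}

/-- Transpose of a relation. -/
def RelTrans {X Y : Type} (R : Set (Y × X)) : Set (X × Y) := {p | (p.2, p.1) ∈ R}

/-! ## Coarse spaces -/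

/-- A coarse structure on a set `X`. -/
structure CoarseSpace (X : Type) where
  entourages : Set (Set (X × X))
  diagonal_mem : {p : X × X | p.1 = p.2} ∈ entourages
  mem_of_subset : ∀ {E F : Set (X × X)}, E ∈ entourages → F ⊆ E → F ∈ entourages
  union_mem : ∀ {E F : Set (X × X)}, E ∈ entourages → F ∈ entourages → E ∪ F ∈ entourages
  transpose_mem : ∀ {E : Set (X × X)}, E ∈ entourages → RelTrans E ∈ entourages
  comp_mem : ∀ {E F : Set (X × X)}, E ∈ entourages → F ∈ entourages → RelComp E F ∈ entourages

namespace CoarseSpace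

variable {X Y : Type}

/-- A gauge: a symmetric entourage containing the diagonal. -/
def IsGauge (C : CoarseSpace X) (E : Set (X × X)) : Prop :=
  E ∈ C.entourages ∧ RelTrans E = E ∧ {p : X × X | p.1 = p.2} ⊆ E

/-- The `E`-neighbourhood `E[A]` of a set `A`. -/
def nbhd (E : Set (X × X)) (A : Set X) : Set X := {x | ∃ a ∈ A, (x, a) ∈ E}

/-- A set is bounded if `A × A` is contained in some entourage. -/
def IsBounded (C : CoarseSpace X) (A : Set X) : Prop := ∃ E ∈ C.entourages, A ×ˢ A ⊆ E

/-- `A ≺ B` : `A` is subordinate to `B`. -/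
def Subordinate (C : CoarseSpace X) (A B : Set X) : Prop := ∃ E ∈ C.entourages, A ⊆ nbhd E B

/-- `A ≍ B` : asymptotic equivalence of subsets. -/
def Asymptotic (C : CoarseSpace X) (A B : Set X) : Prop :=
  C.Subordinate A B ∧ C.Subordinate B A

/-- A coarse map between coarse spaces. -/
def IsCoarseMap (CX : CoarseSpace X) (CY : CoarseSpace Y) (f : X → Y) : Prop :=
  ∀ E ∈ CX.entourages, (fun p : X × X => (f p.1, f p.2)) '' E ∈ CY.entourages

/-- Two maps are close. -/
def Close (CX : CoarseSpace X) (CY : CoarseSpace Y) (f g : X → Y) : Prop :=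
  ∀ E ∈ CX.entourages, (fun p : X × X => (f p.1, g p.2)) '' E ∈ CY.entourages

/-- A coarse equivalence (of maps). -/
def IsCoarseEquivMap (CX : CoarseSpace X) (CY : CoarseSpace Y) (f : X → Y) : Prop :=
  IsCoarseMap CX CY f ∧ ∃ g : Y → X, IsCoarseMap CY CX g ∧
    Close CY CY (f ∘ g) id ∧ Close CX CX (g ∘ f) id

/-- A coarse embedding: a coarse map which is in addition expansive (equivalently, a coarse
equivalence onto its image with the subspace coarse structure). -/
def IsCoarseEmbedding (CX : CoarseSpace X) (CY : CoarseSpace Y) (f : X → Y) : Prop :=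
  IsCoarseMap CX CY f ∧
    ∀ F ∈ CY.entourages, {p : X × X | (f p.1, f p.2) ∈ F} ∈ CX.entourages

/-- A coarse structure is countably generated if it is the smallest coarse structure
containing some countable family of subsets of `X × X`. -/
def IsCountablyGenerated (C : CoarseSpace X) : Prop :=
  ∃ G : Set (Set (X × X)), G.Countable ∧ G ⊆ C.entourages ∧
    ∀ C' : CoarseSpace X, G ⊆ C'.entourages → C.entourages ⊆ C'.entourages

end CoarseSpace

/-- Subordination of relations `R₁, R₂ ⊆ Y × X` with respect to the product coarse structure. -/
def RelSub {X Y : Type} (CX : CoarseSpace X) (CY : CoarseSpace Y)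
    (R₁ R₂ : Set (Y × X)) : Prop :=
  ∃ F ∈ CY.entourages, ∃ E ∈ CX.entourages,
    ∀ p ∈ R₁, ∃ q ∈ R₂, (p.1, q.1) ∈ F ∧ (p.2, q.2) ∈ E

/-- Asymptotic equivalence of relations `R₁, R₂ ⊆ Y × X`. -/
def RelAsymp {X Y : Type} (CX : CoarseSpace X) (CY : CoarseSpace Y)
    (R₁ R₂ : Set (Y × X)) : Prop :=
  RelSub CX CY R₁ R₂ ∧ RelSub CX CY R₂ R₁

/-! ## LFCM spaces -/

/-- A discrete partition of a coarse space endowed with a Boolean algebra `meas` of subsets: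
a measurable, locally finite, controlled partition `P` such that a set is measurable iff its
intersection with every block is measurable. -/
structure IsDiscretePartition {X : Type} (C : CoarseSpace X) (meas : Set (Set X))
    (P : Set (Set X)) : Prop where
  nonempty : ∀ A ∈ P, A.Nonempty
  pairwiseDisjoint : ∀ A ∈ P, ∀ B ∈ P, A ≠ B → Disjoint A B
  covers : ⋃₀ P = Set.univ
  measurable : P ⊆ meas
  locallyFinite : ∀ B : Set X, C.IsBounded B → {A | A ∈ P ∧ (A ∩ B).Nonempty}.Finite
  controlled : ∃ E, C.IsGauge E ∧ ∀ A ∈ P, A ×ˢ A ⊆ E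
  meas_iff : ∀ B : Set X, B ∈ meas ↔ ∀ A ∈ P, B ∩ A ∈ meas

/-- A locally finite coarse measurable (LFCM) space: a coarse space together with a Boolean
algebra of subsets admitting a discrete partition (a chosen one is part of the data). -/
structure LFCMSpace (X : Type) where
  coarse : CoarseSpace X
  meas : Set (Set X)
  empty_mem : ∅ ∈ meas
  compl_mem : ∀ {A : Set X}, A ∈ meas → Aᶜ ∈ meas
  union_mem : ∀ {A B : Set X}, A ∈ meas → B ∈ meas → A ∪ B ∈ meas
  partition : Set (Set X)
  isPartition : IsDiscretePartition coarse meas partition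

namespace LFCMSpace

variable {X Y : Type}

/-- The discreteness gauge `E_disc = ⊔_{A ∈ P} A × A` of an LFCM space. -/
def disc (𝒳 : LFCMSpace X) : Set (X × X) := ⋃ A ∈ 𝒳.partition, A ×ˢ A

/-- A discreteness gauge: a gauge bounding the blocks of some discrete partition. -/
def IsDiscretenessGauge (𝒳 : LFCMSpace X) (E : Set (X × X)) : Prop :=
  𝒳.coarse.IsGauge E ∧
    ∃ P, IsDiscretePartition 𝒳.coarse 𝒳.meas P ∧ ∀ A ∈ P, A ×ˢ A ⊆ E

end LFCMSpace

/-- A coarse measurable map between LFCM spaces. -/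
def IsCoarseMeasurableMap {X Y : Type} (𝒳 : LFCMSpace X) (𝒴 : LFCMSpace Y) (f : X → Y) : Prop :=
  CoarseSpace.IsCoarseMap 𝒳.coarse 𝒴.coarse f ∧ ∀ B ∈ 𝒴.meas, f ⁻¹' B ∈ 𝒳.meas

/-! ## Coarse geometric modules -/

/-- A coarse geometric module over an LFCM space `𝒳`: a representation of the Boolean algebra
of measurable sets by orthogonal projections on a complex Hilbert space, nondegenerate on
bounded sets. -/
structure CoarseModule {X : Type} (𝒳 : LFCMSpace X) (H : Type) [NormedAddCommGroup H]
    [InnerProductSpace ℂ H] [CompleteSpace H] where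
  proj : Set X → (H →L[ℂ] H)
  proj_empty : proj ∅ = 0
  proj_selfAdjoint : ∀ A ∈ 𝒳.meas, IsSelfAdjoint (proj A)
  proj_inter : ∀ {A B : Set X}, A ∈ 𝒳.meas → B ∈ 𝒳.meas → proj (A ∩ B) = proj A ∘L proj B
  proj_union : ∀ {A B : Set X}, A ∈ 𝒳.meas → B ∈ 𝒳.meas → Disjoint A B →
      proj (A ∪ B) = proj A + proj B
  nondeg : Dense (↑(Submodule.span ℂ
      (⋃ A ∈ {A | A ∈ 𝒳.meas ∧ 𝒳.coarse.IsBounded A}, Set.range (proj A))) : Set H)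

variable {X Y Z : Type}
variable {H₀ H₁ H₂ H₃ : Type}

/-- The support of a bounded operator between Hilbert spaces carrying representations
`pX`, `pY` of the measurable sets of LFCM spaces `𝒳` (source) and `𝒴` (target). -/
def opSupp [NormedAddCommGroup H₁] [InnerProductSpace ℂ H₁]
    [NormedAddCommGroup H₂] [InnerProductSpace ℂ H₂]
    (𝒳 : LFCMSpace X) (𝒴 : LFCMSpace Y)
    (pX : Set X → (H₁ →L[ℂ] H₁)) (pY : Set Y → (H₂ →L[ℂ] H₂))
    (t : H₁ →L[ℂ] H₂) : Set (Y × X) :=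
  ⋃₀ {S | ∃ B A, S = B ×ˢ A ∧ B ∈ 𝒴.meas ∧ B ×ˢ B ⊆ 𝒴.disc ∧
      A ∈ 𝒳.meas ∧ A ×ˢ A ⊆ 𝒳.disc ∧ pY B ∘L t ∘L pX A ≠ 0}

/-- Controlled propagation of an operator between modules over the same LFCM space. -/
def HasControlledPropagation [NormedAddCommGroup H₁] [InnerProductSpace ℂ H₁]
    [NormedAddCommGroup H₂] [InnerProductSpace ℂ H₂]
    (𝒳 : LFCMSpace X) (pX : Set X → (H₁ →L[ℂ] H₁)) (pY : Set X → (H₂ →L[ℂ] H₂))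
    (t : H₁ →L[ℂ] H₂) : Prop :=
  opSupp 𝒳 𝒳 pX pY t ∈ 𝒳.coarse.entourages

/-- Approximable operators: norm-limits of controlled propagation operators. -/
def Approximable [NormedAddCommGroup H₁] [InnerProductSpace ℂ H₁]
    [NormedAddCommGroup H₂] [InnerProductSpace ℂ H₂]
    (𝒳 : LFCMSpace X) (pX : Set X → (H₁ →L[ℂ] H₁)) (pY : Set X → (H₂ →L[ℂ] H₂))
    (t : H₁ →L[ℂ] H₂) : Prop :=
  ∀ ε : ℝ, 0 < ε → ∃ s : H₁ →L[ℂ] H₂, HasControlledPropagation 𝒳 pX pY s ∧ ‖t - s‖ ≤ ε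

/-- The rank (Hilbert dimension of the range) of an operator. -/
def projRank {H : Type} [NormedAddCommGroup H] [InnerProductSpace ℂ H]
    (p : H →L[ℂ] H) : Cardinal :=
  LinearMap.rank (p : H →ₗ[ℂ] H)

/-- The `κ`-domain of a coarse module, computed with respect to an arbitrary gauge `E`. -/
def domKappaAt {X : Type} {H : Type} [NormedAddCommGroup H] [InnerProductSpace ℂ H]
    [CompleteSpace H] (𝒳 : LFCMSpace X) (M : CoarseModule 𝒳 H) (E : Set (X × X))
    (κ : Cardinal) : Set X :=
  ⋃₀ {A | A ∈ 𝒳.meas ∧ A ×ˢ A ⊆ E ∧ κ ≤ projRank (M.proj A)}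

/-- The `κ`-domain of a coarse module (with respect to the discreteness gauge). -/
def domKappa {X : Type} {H : Type} [NormedAddCommGroup H] [InnerProductSpace ℂ H]
    [CompleteSpace H] (𝒳 : LFCMSpace X) (M : CoarseModule 𝒳 H) (κ : Cardinal) : Set X :=
  domKappaAt 𝒳 M 𝒳.disc κ

/-- A coarse module is faithful if its faithfulness domain is asymptotic to the whole space. -/
def IsFaithfulMod {X : Type} {H : Type} [NormedAddCommGroup H] [InnerProductSpace ℂ H]
    [CompleteSpace H] (𝒳 : LFCMSpace X) (M : CoarseModule 𝒳 H) : Prop :=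
  𝒳.coarse.Asymptotic (domKappa 𝒳 M 1) Set.univ

/-- A coarse module is ample if its ampleness domain is asymptotic to the whole space. -/
def IsAmpleMod {X : Type} {H : Type} [NormedAddCommGroup H] [InnerProductSpace ℂ H]
    [CompleteSpace H] (𝒳 : LFCMSpace X) (M : CoarseModule 𝒳 H) : Prop :=
  𝒳.coarse.Asymptotic (domKappa 𝒳 M Cardinal.aleph0) Set.univ

/-- The approximate relation `f^T_{δ,F,E}` of a bounded operator. -/
def approxRel [NormedAddCommGroup H₁] [InnerProductSpace ℂ H₁]
    [NormedAddCommGroup H₂] [InnerProductSpace ℂ H₂]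
    (𝒳 : LFCMSpace X) (𝒴 : LFCMSpace Y)
    (pX : Set X → (H₁ →L[ℂ] H₁)) (pY : Set Y → (H₂ →L[ℂ] H₂))
    (T : H₁ →L[ℂ] H₂) (δ : ℝ) (F : Set (Y × Y)) (E : Set (X × X)) : Set (Y × X) :=
  ⋃₀ {S | ∃ B A, S = B ×ˢ A ∧ B ∈ 𝒴.meas ∧ B ×ˢ B ⊆ F ∧
      A ∈ 𝒳.meas ∧ A ×ˢ A ⊆ E ∧ δ < ‖pY B ∘L T ∘L pX A‖}

/-- A unitary operator between Hilbert spaces. -/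
def IsUnitaryOp [NormedAddCommGroup H₁] [InnerProductSpace ℂ H₁] [CompleteSpace H₁]
    [NormedAddCommGroup H₂] [InnerProductSpace ℂ H₂] [CompleteSpace H₂]
    (U : H₁ →L[ℂ] H₂) : Prop :=
  ContinuousLinearMap.adjoint U ∘L U = ContinuousLinearMap.id ℂ H₁ ∧
    U ∘L ContinuousLinearMap.adjoint U = ContinuousLinearMap.id ℂ H₂

/-- A central unitary of the C*-algebra of approximable operators on a coarse module. -/
def IsCentralUnitary {X : Type} {H : Type} [NormedAddCommGroup H] [InnerProductSpace ℂ H]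
    [CompleteSpace H] (𝒳 : LFCMSpace X) (M : CoarseModule 𝒳 H) (u : H →L[ℂ] H) : Prop :=
  Approximable 𝒳 M.proj M.proj u ∧ IsUnitaryOp u ∧
    ∀ t : H →L[ℂ] H, Approximable 𝒳 M.proj M.proj t → u ∘L t = t ∘L u

/-- Equivalence of operators modulo central unitaries. -/
def CongruentModCentral {X : Type} [NormedAddCommGroup H₁] [InnerProductSpace ℂ H₁]
    [CompleteSpace H₁] [NormedAddCommGroup H₂] [InnerProductSpace ℂ H₂] [CompleteSpace H₂]
    (𝒳 : LFCMSpace X) (C : CoarseModule 𝒳 H₁) (D : CoarseModule 𝒳 H₂)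
    (t s : H₁ →L[ℂ] H₂) : Prop :=
  ∃ u v, IsCentralUnitary 𝒳 C u ∧ IsCentralUnitary 𝒳 D v ∧ t = v ∘L s ∘L u

/-! ## Direct sums of modules -/

/-- The direct sum `T ⊕ S` of two operators, on the `ℓ²`-product of Hilbert spaces. -/
def prodOp [NormedAddCommGroup H₀] [InnerProductSpace ℂ H₀]
    [NormedAddCommGroup H₁] [InnerProductSpace ℂ H₁]
    [NormedAddCommGroup H₂] [InnerProductSpace ℂ H₂]
    [NormedAddCommGroup H₃] [InnerProductSpace ℂ H₃]
    (T : H₀ →L[ℂ] H₂) (S : H₁ →L[ℂ] H₃) :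
    WithLp 2 (H₀ × H₁) →L[ℂ] WithLp 2 (H₂ × H₃) :=
  (WithLp.prodContinuousLinearEquiv 2 ℂ H₂ H₃).symm.toContinuousLinearMap ∘L
    (T.prodMap S) ∘L (WithLp.prodContinuousLinearEquiv 2 ℂ H₀ H₁).toContinuousLinearMap

/-- The canonical inclusion `H₀ → H₀ ⊕ H₁`. -/
def inlOp (H₀ H₁ : Type) [NormedAddCommGroup H₀] [InnerProductSpace ℂ H₀]
    [NormedAddCommGroup H₁] [InnerProductSpace ℂ H₁] :
    H₀ →L[ℂ] WithLp 2 (H₀ × H₁) :=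
  (WithLp.prodContinuousLinearEquiv 2 ℂ H₀ H₁).symm.toContinuousLinearMap ∘L
    ContinuousLinearMap.inl ℂ H₀ H₁

/-- The canonical inclusion `H₁ → H₀ ⊕ H₁`. -/
def inrOp (H₀ H₁ : Type) [NormedAddCommGroup H₀] [InnerProductSpace ℂ H₀]
    [NormedAddCommGroup H₁] [InnerProductSpace ℂ H₁] :
    H₁ →L[ℂ] WithLp 2 (H₀ × H₁) :=
  (WithLp.prodContinuousLinearEquiv 2 ℂ H₀ H₁).symm.toContinuousLinearMap ∘L
    ContinuousLinearMap.inr ℂ H₀ H₁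

/-- The canonical projection `H₀ ⊕ H₁ → H₀`. -/
def fstOp (H₀ H₁ : Type) [NormedAddCommGroup H₀] [InnerProductSpace ℂ H₀]
    [NormedAddCommGroup H₁] [InnerProductSpace ℂ H₁] :
    WithLp 2 (H₀ × H₁) →L[ℂ] H₀ :=
  ContinuousLinearMap.fst ℂ H₀ H₁ ∘L
    (WithLp.prodContinuousLinearEquiv 2 ℂ H₀ H₁).toContinuousLinearMap

/-- The canonical projection `H₀ ⊕ H₁ → H₁`. -/
def sndOp (H₀ H₁ : Type) [NormedAddCommGroup H₀] [InnerProductSpace ℂ H₀]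
    [NormedAddCommGroup H₁] [InnerProductSpace ℂ H₁] :
    WithLp 2 (H₀ × H₁) →L[ℂ] H₁ :=
  ContinuousLinearMap.snd ℂ H₀ H₁ ∘L
    (WithLp.prodContinuousLinearEquiv 2 ℂ H₀ H₁).toContinuousLinearMap

/-- `M` is the direct sum of the coarse modules `C₀` and `C₁`. -/
def IsDirectSum {X : Type} [NormedAddCommGroup H₀] [InnerProductSpace ℂ H₀] [CompleteSpace H₀]
    [NormedAddCommGroup H₁] [InnerProductSpace ℂ H₁] [CompleteSpace H₁]
    (𝒳 : LFCMSpace X) (C₀ : CoarseModule 𝒳 H₀) (C₁ : CoarseModule 𝒳 H₁)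
    (M : CoarseModule 𝒳 (WithLp 2 (H₀ × H₁))) : Prop :=
  ∀ A : Set X, M.proj A = prodOp (C₀.proj A) (C₁.proj A)

/-! ## Bundled modules and *-functors -/

/-- A coarse module over `𝒳` bundled together with its Hilbert space; the objects of the
approximable category `𝒜(𝒳)`. -/
structure BundledModule {X : Type} (𝒳 : LFCMSpace X) where
  H : Type
  [instNorm : NormedAddCommGroup H]
  [instInner : InnerProductSpace ℂ H]
  [instComplete : CompleteSpace H]
  mod : CoarseModule 𝒳 H

attribute [instance] BundledModule.instNorm BundledModule.instInner BundledModule.instComplete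

/-- A *-functor `𝒜(𝒳) → 𝒜(𝒴)` between approximable categories: a map on objects together
with a ℂ-linear, multiplicative, adjoint-preserving map on approximable operators. -/
structure StarFunctor {X Y : Type} (𝒳 : LFCMSpace X) (𝒴 : LFCMSpace Y) where
  obj : BundledModule 𝒳 → BundledModule 𝒴
  map : ∀ {C D : BundledModule 𝒳} (t : C.H →L[ℂ] D.H),
      Approximable 𝒳 C.mod.proj D.mod.proj t → ((obj C).H →L[ℂ] (obj D).H)
  map_approximable : ∀ {C D : BundledModule 𝒳} (t : C.H →L[ℂ] D.H)
      (ht : Approximable 𝒳 C.mod.proj D.mod.proj t),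
      Approximable 𝒴 (obj C).mod.proj (obj D).mod.proj (map t ht)
  map_id : ∀ (C : BundledModule 𝒳)
      (h : Approximable 𝒳 C.mod.proj C.mod.proj (ContinuousLinearMap.id ℂ C.H)),
      map (ContinuousLinearMap.id ℂ C.H) h = ContinuousLinearMap.id ℂ (obj C).H
  map_comp : ∀ {C D G : BundledModule 𝒳} (t : C.H →L[ℂ] D.H) (s : D.H →L[ℂ] G.H)
      (ht : Approximable 𝒳 C.mod.proj D.mod.proj t)
      (hs : Approximable 𝒳 D.mod.proj G.mod.proj s)
      (hst : Approximable 𝒳 C.mod.proj G.mod.proj (s ∘L t)),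
      map (s ∘L t) hst = map s hs ∘L map t ht
  map_add : ∀ {C D : BundledModule 𝒳} (t s : C.H →L[ℂ] D.H)
      (ht : Approximable 𝒳 C.mod.proj D.mod.proj t)
      (hs : Approximable 𝒳 C.mod.proj D.mod.proj s)
      (hts : Approximable 𝒳 C.mod.proj D.mod.proj (t + s)),
      map (t + s) hts = map t ht + map s hs
  map_smul : ∀ {C D : BundledModule 𝒳} (c : ℂ) (t : C.H →L[ℂ] D.H)
      (ht : Approximable 𝒳 C.mod.proj D.mod.proj t)
      (hct : Approximable 𝒳 C.mod.proj D.mod.proj (c • t)),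
      map (c • t) hct = c • map t ht
  map_star : ∀ {C D : BundledModule 𝒳} (t : C.H →L[ℂ] D.H)
      (ht : Approximable 𝒳 C.mod.proj D.mod.proj t)
      (hstar : Approximable 𝒳 D.mod.proj C.mod.proj (ContinuousLinearMap.adjoint t)),
      map (ContinuousLinearMap.adjoint t) hstar = ContinuousLinearMap.adjoint (map t ht)

namespace StarFunctor

variable {𝒳 : LFCMSpace X} {𝒴 : LFCMSpace Y}

/-- A full functor. -/
def Full (F : StarFunctor 𝒳 𝒴) : Prop :=
  ∀ (C D : BundledModule 𝒳) (s : (F.obj C).H →L[ℂ] (F.obj D).H),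
    Approximable 𝒴 (F.obj C).mod.proj (F.obj D).mod.proj s →
    ∃ (t : C.H →L[ℂ] D.H) (ht : Approximable 𝒳 C.mod.proj D.mod.proj t), F.map t ht = s

/-- A faithful functor. -/
def Faithful (F : StarFunctor 𝒳 𝒴) : Prop :=
  ∀ (C D : BundledModule 𝒳) (t t' : C.H →L[ℂ] D.H)
    (ht : Approximable 𝒳 C.mod.proj D.mod.proj t)
    (ht' : Approximable 𝒳 C.mod.proj D.mod.proj t'),
    F.map t ht = F.map t' ht' → t = t'

/-- An essentially surjective functor (up to isomorphism in the approximable category). -/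
def EssSurj (F : StarFunctor 𝒳 𝒴) : Prop :=
  ∀ D' : BundledModule 𝒴, ∃ C : BundledModule 𝒳,
    ∃ u : (F.obj C).H →L[ℂ] D'.H, Approximable 𝒴 (F.obj C).mod.proj D'.mod.proj u ∧
    ∃ v : D'.H →L[ℂ] (F.obj C).H, Approximable 𝒴 D'.mod.proj (F.obj C).mod.proj v ∧
      v ∘L u = ContinuousLinearMap.id ℂ (F.obj C).H ∧
      u ∘L v = ContinuousLinearMap.id ℂ D'.H

/-- A unitary `U` implements the *-isomorphism induced by `F` on the endomorphism algebra of
a module `C`. -/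
def Implements (F : StarFunctor 𝒳 𝒴) (C : BundledModule 𝒳)
    (U : C.H →L[ℂ] (F.obj C).H) : Prop :=
  IsUnitaryOp U ∧ ∀ (t : C.H →L[ℂ] C.H) (ht : Approximable 𝒳 C.mod.proj C.mod.proj t),
    F.map t ht = U ∘L t ∘L ContinuousLinearMap.adjoint U

end StarFunctor

/-- The graph of a map, as a relation `⊆ Y × X`. -/
def mapGraph {X Y : Type} (f : X → Y) : Set (Y × X) := {p | p.1 = f p.2}

/-- A relation `R ⊆ Y × X` is a coarse equivalence from `DX ⊆ X` to `DY ⊆ Y` (each with the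
subspace coarse structure): controlled in both directions, densely defined and coarsely
surjective relative to `DX` and `DY`. -/
def IsRelCoarseEquivOn {X Y : Type} (CX : CoarseSpace X) (CY : CoarseSpace Y)
    (DX : Set X) (DY : Set Y) (R : Set (Y × X)) : Prop :=
  (∀ E ∈ CX.entourages, RelComp R (RelComp E (RelTrans R)) ∈ CY.entourages) ∧
  (∀ F ∈ CY.entourages, RelComp (RelTrans R) (RelComp F R) ∈ CX.entourages) ∧
  CX.Asymptotic (Prod.snd '' R) DX ∧ CY.Asymptotic (Prod.fst '' R) DY

/-- `S ⊆ X × Y` is a coarse inverse of the relation `R ⊆ Y × X` between `DX` and `DY`: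
both compositions are asymptotic to the respective (restricted) diagonals. -/
def IsRelCoarseInverseOn {X Y : Type} (CX : CoarseSpace X) (CY : CoarseSpace Y)
    (DX : Set X) (DY : Set Y) (R : Set (Y × X)) (S : Set (X × Y)) : Prop :=
  RelAsymp CX CX (RelComp S R) {p : X × X | p.1 = p.2 ∧ p.1 ∈ DX} ∧
  RelAsymp CY CY (RelComp R S) {p : Y × Y | p.1 = p.2 ∧ p.1 ∈ DY}

/-- The statement that a coarse map `f` represents the coarse embedding induced by a full and
faithful *-functor `F` via approximate relations of implementing unitaries. -/
def RepresentsInducedEmbedding {X Y : Type} {𝒳 : LFCMSpace X} {𝒴 : LFCMSpace Y}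
    (F : StarFunctor 𝒳 𝒴) (f : X → Y) : Prop :=
  ∀ (C : BundledModule 𝒳), IsFaithfulMod 𝒳 C.mod →
  ∀ (U : C.H →L[ℂ] (F.obj C).H), F.Implements C U →
  ∀ δ : ℝ, 0 < δ → δ < 1 →
  ∃ F₀ ∈ 𝒴.coarse.entourages, ∃ E₀ ∈ 𝒳.coarse.entourages,
    ∀ F' ∈ 𝒴.coarse.entourages, F₀ ⊆ F' → ∀ E ∈ 𝒳.coarse.entourages, E₀ ⊆ E →
      RelAsymp 𝒳.coarse 𝒴.coarse
        (approxRel 𝒳 𝒴 C.mod.proj (F.obj C).mod.proj U δ F' E) (mapGraph f)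

/-- Bundle a coarse module into an object of the approximable category. -/
abbrev BundledModule.ofModule {X : Type} {𝒳 : LFCMSpace X} {H : Type} [NormedAddCommGroup H]
    [InnerProductSpace ℂ H] [CompleteSpace H] (M : CoarseModule 𝒳 H) : BundledModule 𝒳 :=
  ⟨H, M⟩

theorem LFCMSpace.disc_mem {X : Type} (𝒳 : LFCMSpace X) :
    𝒳.disc ∈ 𝒳.coarse.entourages := by
  obtain ⟨E, hE, hEP⟩ := 𝒳.isPartition.controlled
  refine 𝒳.coarse.mem_of_subset hE.1 ?_
  intro p hp
  simp only [LFCMSpace.disc, Set.mem_iUnion] at hp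
  obtain ⟨A, hA, hpA⟩ := hp
  exact hEP A hA hpA

theorem prodOp_comp_inlOp {H₀ H₁ H₂ H₃ : Type}
    [NormedAddCommGroup H₀] [InnerProductSpace ℂ H₀]
    [NormedAddCommGroup H₁] [InnerProductSpace ℂ H₁]
    [NormedAddCommGroup H₂] [InnerProductSpace ℂ H₂]
    [NormedAddCommGroup H₃] [InnerProductSpace ℂ H₃]
    (T : H₀ →L[ℂ] H₂) (S : H₁ →L[ℂ] H₃) :
    prodOp T S ∘L inlOp H₀ H₁ = inlOp H₂ H₃ ∘L T := by
  ext x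
  simp [prodOp, inlOp]

theorem prodOp_comp_inrOp {H₀ H₁ H₂ H₃ : Type}
    [NormedAddCommGroup H₀] [InnerProductSpace ℂ H₀]
    [NormedAddCommGroup H₁] [InnerProductSpace ℂ H₁]
    [NormedAddCommGroup H₂] [InnerProductSpace ℂ H₂]
    [NormedAddCommGroup H₃] [InnerProductSpace ℂ H₃]
    (T : H₀ →L[ℂ] H₂) (S : H₁ →L[ℂ] H₃) :
    prodOp T S ∘L inrOp H₀ H₁ = inrOp H₂ H₃ ∘L S := by
  ext x
  simp [prodOp, inrOp]

/-- The canonical inclusion into a direct sum of coarse modules is approximable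
(indeed it has controlled propagation). -/
theorem IsDirectSum.approximable_inl {X : Type} {H₀ H₁ : Type}
    [NormedAddCommGroup H₀] [InnerProductSpace ℂ H₀] [CompleteSpace H₀]
    [NormedAddCommGroup H₁] [InnerProductSpace ℂ H₁] [CompleteSpace H₁]
    {𝒳 : LFCMSpace X} {C₀ : CoarseModule 𝒳 H₀} {C₁ : CoarseModule 𝒳 H₁}
    {M : CoarseModule 𝒳 (WithLp 2 (H₀ × H₁))} (hM : IsDirectSum 𝒳 C₀ C₁ M) :
    Approximable 𝒳 C₀.proj M.proj (inlOp H₀ H₁) := by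
  intro ε hε
  refine ⟨inlOp H₀ H₁, ?_, by simp [hε.le]⟩
  refine 𝒳.coarse.mem_of_subset (𝒳.coarse.comp_mem 𝒳.disc_mem 𝒳.disc_mem) ?_
  rintro ⟨y, x⟩ hyx
  obtain ⟨s, ⟨B, A, rfl, hBmeas, hBb, hAmeas, hAb, hne⟩, hmem⟩ := hyx
  have key : M.proj B ∘L inlOp H₀ H₁ ∘L C₀.proj A
      = inlOp H₀ H₁ ∘L C₀.proj (B ∩ A) := by
    rw [C₀.proj_inter hBmeas hAmeas, hM B, ← ContinuousLinearMap.comp_assoc,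
      prodOp_comp_inlOp, ContinuousLinearMap.comp_assoc]
  have hBA : (B ∩ A).Nonempty := by
    by_contra h
    rw [Set.not_nonempty_iff_eq_empty] at h
    apply hne
    rw [key, h, C₀.proj_empty]
    ext z
    simp
  obtain ⟨z, hzB, hzA⟩ := hBA
  obtain ⟨hyB, hxA⟩ := hmem
  exact ⟨z, hBb ⟨hyB, hzB⟩, hAb ⟨hzA, hxA⟩⟩

theorem IsDirectSum.approximable_inr {X : Type} {H₀ H₁ : Type}
    [NormedAddCommGroup H₀] [InnerProductSpace ℂ H₀] [CompleteSpace H₀]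
    [NormedAddCommGroup H₁] [InnerProductSpace ℂ H₁] [CompleteSpace H₁]
    {𝒳 : LFCMSpace X} {C₀ : CoarseModule 𝒳 H₀} {C₁ : CoarseModule 𝒳 H₁}
    {M : CoarseModule 𝒳 (WithLp 2 (H₀ × H₁))} (hM : IsDirectSum 𝒳 C₀ C₁ M) :
    Approximable 𝒳 C₁.proj M.proj (inrOp H₀ H₁) := by
  intro ε hε
  refine ⟨inrOp H₀ H₁, ?_, by simp [hε.le]⟩
  refine 𝒳.coarse.mem_of_subset (𝒳.coarse.comp_mem 𝒳.disc_mem 𝒳.disc_mem) ?_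
  rintro ⟨y, x⟩ hyx
  obtain ⟨s, ⟨B, A, rfl, hBmeas, hBb, hAmeas, hAb, hne⟩, hmem⟩ := hyx
  have key : M.proj B ∘L inrOp H₀ H₁ ∘L C₁.proj A
      = inrOp H₀ H₁ ∘L C₁.proj (B ∩ A) := by
    rw [C₁.proj_inter hBmeas hAmeas, hM B, ← ContinuousLinearMap.comp_assoc,
      prodOp_comp_inrOp, ContinuousLinearMap.comp_assoc]
  have hBA : (B ∩ A).Nonempty := by
    by_contra h
    rw [Set.not_nonempty_iff_eq_empty] at h
    apply hne
    rw [key, h, C₁.proj_empty]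
    ext z
    simp
  obtain ⟨z, hzB, hzA⟩ := hBA
  obtain ⟨hyB, hxA⟩ := hmem
  exact ⟨z, hBb ⟨hyB, hzB⟩, hAb ⟨hzA, hxA⟩⟩

namespace CoarseSpace

/-- A countably generated coarse structure has an increasing cofinal sequence of entourages. -/
theorem exists_monotone_cofinal (C : CoarseSpace X) (h : C.IsCountablyGenerated) :
    ∃ F : ℕ → Set (X × X), Monotone F ∧ (∀ n, F n ∈ C.entourages) ∧
      ∀ E ∈ C.entourages, ∃ n, E ⊆ F n := by
  obtain ⟨G, hGc, hGC, hmin⟩ := h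
  obtain ⟨f, hf⟩ := (hGc.insert {p : X × X | p.1 = p.2}).exists_eq_range
    (Set.insert_nonempty _ _)
  have hfC : ∀ n, f n ∈ C.entourages := by
    intro n
    have : f n ∈ insert {p : X × X | p.1 = p.2} G := hf ▸ Set.mem_range_self n
    rcases this with h | h
    · rw [h]; exact C.diagonal_mem
    · exact hGC h
  let step : ℕ → Set (X × X) → Set (X × X) := fun n S => S ∪ (f n ∪ RelTrans (f n))
  let F : ℕ → Set (X × X) := fun n =>
    Nat.rec {p : X × X | p.1 = p.2} (fun n S => RelComp (step n S) (step n S)) n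
  have hF0 : F 0 = {p : X × X | p.1 = p.2} := rfl
  have hFs : ∀ n, F (n + 1) = RelComp (step n (F n)) (step n (F n)) := fun n => rfl
  have hFC : ∀ n, F n ∈ C.entourages := by
    intro n
    induction n with
    | zero => rw [hF0]; exact C.diagonal_mem
    | succ n ih =>
      have : step n (F n) ∈ C.entourages :=
        C.union_mem ih (C.union_mem (hfC n) (C.transpose_mem (hfC n)))
      rw [hFs]; exact C.comp_mem this this
  have hdiag : ∀ n x, (x, x) ∈ F n := by
    intro n
    induction n with
    | zero => intro x; rw [hF0]; rfl
    | succ n ih => intro x; rw [hFs]; exact ⟨x, Or.inl (ih x), Or.inl (ih x)⟩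
  have hsymm : ∀ n x y, (x, y) ∈ F n → (y, x) ∈ F n := by
    intro n
    induction n with
    | zero => intro x y h; rw [hF0] at *; exact Eq.symm h
    | succ n ih =>
      have hs : ∀ x y, (x, y) ∈ step n (F n) → (y, x) ∈ step n (F n) := by
        rintro x y (h | h | h)
        · exact Or.inl (ih _ _ h)
        · exact Or.inr (Or.inr h)
        · exact Or.inr (Or.inl h)
      rintro x y ⟨z, h1, h2⟩
      exact ⟨z, hs _ _ h2, hs _ _ h1⟩
  have hcomp : ∀ n, RelComp (F n) (F n) ⊆ F (n + 1) := by
    rintro n ⟨x, y⟩ ⟨z, h1, h2⟩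
    exact ⟨z, Or.inl h1, Or.inl h2⟩
  have hmono : Monotone F := monotone_nat_of_le_succ fun n p hp =>
    hcomp n ⟨p.2, hp, hdiag n p.2⟩
  let C' : CoarseSpace X :=
    { entourages := {E | ∃ n, E ⊆ F n}
      diagonal_mem := ⟨0, subset_rfl⟩
      mem_of_subset := fun ⟨n, hn⟩ h => ⟨n, h.trans hn⟩
      union_mem := fun ⟨n, hn⟩ ⟨m, hm⟩ => ⟨max n m, Set.union_subset
        (hn.trans (hmono (le_max_left _ _))) (hm.trans (hmono (le_max_right _ _)))⟩
      transpose_mem := fun ⟨n, hn⟩ => ⟨n, fun p hp => hsymm n _ _ (hn hp)⟩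
      comp_mem := fun ⟨n, hn⟩ ⟨m, hm⟩ => ⟨max n m + 1, by
        rintro ⟨x, y⟩ ⟨z, h1, h2⟩
        exact hcomp _ ⟨z, hmono (le_max_left _ _) (hn h1), hmono (le_max_right _ _) (hm h2)⟩⟩ }
  refine ⟨F, hmono, hFC, fun E hE => hmin C' ?_ hE⟩
  intro g hg
  have : g ∈ Set.range f := hf ▸ Set.mem_insert_of_mem _ hg
  obtain ⟨n, rfl⟩ := this
  refine ⟨n + 1, ?_⟩
  rintro ⟨x, y⟩ hxy
  exact ⟨y, Or.inr (Or.inl hxy), Or.inl (hdiag n y)⟩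

theorem biUnion_finset_mem {ι : Type} (C : CoarseSpace X) (s : Finset ι) (E : ι → Set (X × X))
    (hE : ∀ i ∈ s, E i ∈ C.entourages) : (⋃ i ∈ s, E i) ∈ C.entourages := by
  classical
  induction s using Finset.induction_on with
  | empty => exact C.mem_of_subset C.diagonal_mem (by simp)
  | insert a s _ ih =>
    rw [Finset.set_biUnion_insert]
    exact C.union_mem (hE _ (Finset.mem_insert_self _ _))
      (ih fun i hi => hE i (Finset.mem_insert_of_mem hi))

end CoarseSpace

namespace LFCMSpace

variable (𝒳 : LFCMSpace X)

theorem univ_mem : Set.univ ∈ 𝒳.meas := by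
  simpa using 𝒳.compl_mem 𝒳.empty_mem

variable {𝒳}

theorem inter_mem {A B : Set X} (hA : A ∈ 𝒳.meas) (hB : B ∈ 𝒳.meas) : A ∩ B ∈ 𝒳.meas := by
  simpa [Set.compl_union] using 𝒳.compl_mem (𝒳.union_mem (𝒳.compl_mem hA) (𝒳.compl_mem hB))

theorem eq_of_mem_partition {P Q : Set X} (hP : P ∈ 𝒳.partition) (hQ : Q ∈ 𝒳.partition) {x : X}
    (hxP : x ∈ P) (hxQ : x ∈ Q) : P = Q := by
  by_contra h
  exact Set.disjoint_left.1 (𝒳.isPartition.pairwiseDisjoint P hP Q hQ h) hxP hxQ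

theorem exists_mem_partition (x : X) : ∃ P ∈ 𝒳.partition, x ∈ P := by
  have : x ∈ ⋃₀ 𝒳.partition := 𝒳.isPartition.covers ▸ Set.mem_univ x
  exact this

theorem meas_of_mem_partition {P : Set X} (hP : P ∈ 𝒳.partition) : P ∈ 𝒳.meas :=
  𝒳.isPartition.measurable hP

theorem mem_disc {x y : X} : (x, y) ∈ 𝒳.disc ↔ ∃ P ∈ 𝒳.partition, x ∈ P ∧ y ∈ P := by
  simp only [disc, Set.mem_iUnion, Set.mem_prod, exists_prop]

theorem disc_refl (x : X) : (x, x) ∈ 𝒳.disc := by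
  obtain ⟨P, hP, hx⟩ := 𝒳.exists_mem_partition x
  exact mem_disc.2 ⟨P, hP, hx, hx⟩

theorem prod_subset_disc {P : Set X} (hP : P ∈ 𝒳.partition) : P ×ˢ P ⊆ 𝒳.disc :=
  fun _ hp => mem_disc.2 ⟨P, hP, hp.1, hp.2⟩

theorem mem_of_disc {P : Set X} (hP : P ∈ 𝒳.partition) {x y : X} (h : (x, y) ∈ 𝒳.disc)
    (hy : y ∈ P) : x ∈ P := by
  obtain ⟨Q, hQ, hx, hy'⟩ := mem_disc.1 h
  rwa [eq_of_mem_partition hP hQ hy hy']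

theorem sUnion_meas {𝒬 : Set (Set X)} (h : 𝒬 ⊆ 𝒳.partition) : ⋃₀ 𝒬 ∈ 𝒳.meas := by
  rw [𝒳.isPartition.meas_iff]
  intro P hP
  by_cases hPQ : P ∈ 𝒬
  · have : ⋃₀ 𝒬 ∩ P = P := Set.inter_eq_right.2 (Set.subset_sUnion_of_mem hPQ)
    rw [this]; exact meas_of_mem_partition hP
  · have : ⋃₀ 𝒬 ∩ P = ∅ := by
      rw [Set.eq_empty_iff_forall_notMem]
      rintro x ⟨⟨Q, hQ, hxQ⟩, hxP⟩
      exact hPQ (eq_of_mem_partition hP (h hQ) hxP hxQ ▸ hQ)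
    rw [this]; exact 𝒳.empty_mem

theorem nbhd_disc_meas (S : Set X) : CoarseSpace.nbhd 𝒳.disc S ∈ 𝒳.meas := by
  have : CoarseSpace.nbhd 𝒳.disc S = ⋃₀ {P | P ∈ 𝒳.partition ∧ (P ∩ S).Nonempty} := by
    ext x
    constructor
    · rintro ⟨a, ha, hxa⟩
      obtain ⟨P, hP, hx, ha'⟩ := mem_disc.1 hxa
      exact ⟨P, ⟨hP, a, ha', ha⟩, hx⟩
    · rintro ⟨P, ⟨hP, a, ha', ha⟩, hx⟩
      exact ⟨a, ha, mem_disc.2 ⟨P, hP, hx, ha'⟩⟩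
  rw [this]
  exact sUnion_meas fun P hP => hP.1

theorem subset_nbhd_disc (S : Set X) : S ⊆ CoarseSpace.nbhd 𝒳.disc S :=
  fun x hx => ⟨x, hx, disc_refl x⟩

end LFCMSpace

namespace CoarseModule

variable [NormedAddCommGroup H₁] [InnerProductSpace ℂ H₁] [CompleteSpace H₁]
variable {𝒳 : LFCMSpace X} (M : CoarseModule 𝒳 H₁)

theorem proj_proj {A B : Set X} (hA : A ∈ 𝒳.meas) (hB : B ∈ 𝒳.meas) (x : H₁) :
    M.proj A (M.proj B x) = M.proj (A ∩ B) x := by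
  rw [M.proj_inter hA hB]; rfl

theorem proj_proj_of_subset {A B : Set X} (hA : A ∈ 𝒳.meas) (hB : B ∈ 𝒳.meas) (h : A ⊆ B)
    (x : H₁) : M.proj A (M.proj B x) = M.proj A x := by
  rw [M.proj_proj hA hB, Set.inter_eq_left.2 h]

theorem proj_proj_of_superset {A B : Set X} (hA : A ∈ 𝒳.meas) (hB : B ∈ 𝒳.meas) (h : B ⊆ A)
    (x : H₁) : M.proj A (M.proj B x) = M.proj B x := by
  rw [M.proj_proj hA hB, Set.inter_eq_right.2 h]

theorem proj_proj_of_disjoint {A B : Set X} (hA : A ∈ 𝒳.meas) (hB : B ∈ 𝒳.meas)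
    (h : Disjoint A B) (x : H₁) : M.proj A (M.proj B x) = 0 := by
  rw [M.proj_proj hA hB, Set.disjoint_iff_inter_eq_empty.1 h, M.proj_empty]; rfl

theorem inner_proj_left {A : Set X} (hA : A ∈ 𝒳.meas) (x y : H₁) :
    inner ℂ (M.proj A x) y = inner ℂ x (M.proj A y) :=
  (M.proj_selfAdjoint A hA).isSymmetric x y

theorem adjoint_proj {A : Set X} (hA : A ∈ 𝒳.meas) :
    ContinuousLinearMap.adjoint (M.proj A) = M.proj A :=
  (M.proj_selfAdjoint A hA).adjoint_eq

theorem inner_proj_self {A : Set X} (hA : A ∈ 𝒳.meas) (x : H₁) :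
    inner ℂ x (M.proj A x) = (‖M.proj A x‖ : ℂ) ^ 2 := by
  rw [← M.proj_proj_of_subset hA hA subset_rfl, ← M.inner_proj_left hA,
    inner_self_eq_norm_sq_to_K]
  simp [M.proj_proj_of_subset hA hA subset_rfl]

theorem proj_univ (x : H₁) : M.proj Set.univ x = x := by
  have h : (M.proj Set.univ : H₁ → H₁) = id := by
    refine Continuous.ext_on M.nondeg (M.proj Set.univ).continuous continuous_id ?_
    intro v hv
    have : Set.EqOn (M.proj Set.univ) (ContinuousLinearMap.id ℂ H₁)
        ↑(Submodule.span ℂ (⋃ A ∈ {A | A ∈ 𝒳.meas ∧ 𝒳.coarse.IsBounded A},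
          Set.range (M.proj A))) := by
      refine LinearMap.eqOn_span (f := (M.proj Set.univ : H₁ →ₗ[ℂ] H₁))
        (g := (ContinuousLinearMap.id ℂ H₁ : H₁ →ₗ[ℂ] H₁)) ?_
      intro w hw
      simp only [Set.mem_iUnion] at hw
      obtain ⟨A, ⟨hA, -⟩, z, rfl⟩ := hw
      exact M.proj_proj_of_superset 𝒳.univ_mem hA (Set.subset_univ A) z
    exact this hv
  exact congrFun h x

theorem proj_compl_add {A : Set X} (hA : A ∈ 𝒳.meas) (x : H₁) :
    M.proj A x + M.proj Aᶜ x = x := by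
  have := M.proj_union hA (𝒳.compl_mem hA) disjoint_compl_right
  rw [Set.union_compl_self] at this
  conv_rhs => rw [← M.proj_univ x, this]
  rfl

theorem norm_sq_proj_add {A : Set X} (hA : A ∈ 𝒳.meas) (x : H₁) :
    ‖M.proj A x‖ ^ 2 + ‖M.proj Aᶜ x‖ ^ 2 = ‖x‖ ^ 2 := by
  have h : inner ℂ (M.proj A x) (M.proj Aᶜ x) = 0 := by
    rw [M.inner_proj_left hA, M.proj_proj_of_disjoint hA (𝒳.compl_mem hA) disjoint_compl_right,
      inner_zero_right]
  have := norm_add_sq_eq_norm_sq_add_norm_sq_of_inner_eq_zero _ _ h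
  rw [M.proj_compl_add hA] at this
  nlinarith

theorem norm_proj_apply_le {A : Set X} (hA : A ∈ 𝒳.meas) (x : H₁) : ‖M.proj A x‖ ≤ ‖x‖ := by
  have := M.norm_sq_proj_add hA x
  exact le_of_sq_le_sq (by nlinarith [sq_nonneg ‖M.proj Aᶜ x‖]) (norm_nonneg _)

theorem biUnion_meas (s : Finset 𝒳.partition) : (⋃ P ∈ s, (P : Set X)) ∈ 𝒳.meas := by
  have : (⋃ P ∈ s, (P : Set X)) = ⋃₀ ((fun P : 𝒳.partition => (P : Set X)) '' s) := by
    simp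
  rw [this]
  refine LFCMSpace.sUnion_meas ?_
  rintro _ ⟨P, -, rfl⟩
  exact P.2

theorem proj_biUnion (s : Finset 𝒳.partition) (x : H₁) :
    M.proj (⋃ P ∈ s, (P : Set X)) x = ∑ P ∈ s, M.proj P x := by
  classical
  induction s using Finset.induction_on with
  | empty => simp [M.proj_empty]
  | insert P s hP ih =>
    rw [Finset.set_biUnion_insert, Finset.sum_insert hP, ← ih,
      M.proj_union (LFCMSpace.meas_of_mem_partition P.2) (biUnion_meas s)]
    · rfl
    · simp only [Set.disjoint_iUnion_right]
      intro Q hQ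
      refine 𝒳.isPartition.pairwiseDisjoint _ P.2 _ Q.2 ?_
      intro h
      exact hP (Subtype.ext h ▸ hQ)

theorem hasSum_proj_partition (x : H₁) : HasSum (fun P : 𝒳.partition => M.proj P x) x := by
  have hspan : ∀ v ∈ Submodule.span ℂ (⋃ A ∈ {A | A ∈ 𝒳.meas ∧ 𝒳.coarse.IsBounded A},
      Set.range (M.proj A)), HasSum (fun P : 𝒳.partition => M.proj P v) v := by
    intro v hv
    induction hv using Submodule.span_induction with
    | mem v hv =>
      simp only [Set.mem_iUnion] at hv
      obtain ⟨A, ⟨hA, hAb⟩, z, rfl⟩ := hv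
      have hfin : {P : 𝒳.partition | ((P : Set X) ∩ A).Nonempty}.Finite := by
        refine Set.Finite.of_finite_image (f := Subtype.val) ?_ Subtype.val_injective.injOn
        refine (𝒳.isPartition.locallyFinite A hAb).subset ?_
        rintro _ ⟨P, hP, rfl⟩
        exact ⟨P.2, hP⟩
      have hsum : ∑ P ∈ hfin.toFinset, M.proj P (M.proj A z) = M.proj A z := by
        rw [← M.proj_biUnion]
        refine M.proj_proj_of_superset (biUnion_meas _) hA ?_ z
        intro x hx
        obtain ⟨P, hP, hxP⟩ := 𝒳.exists_mem_partition x
        simp only [Set.mem_iUnion]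
        exact ⟨⟨P, hP⟩, by simpa using ⟨x, hxP, hx⟩, hxP⟩
      have : HasSum (fun P : 𝒳.partition => M.proj P (M.proj A z)) _ :=
        hasSum_sum_of_ne_finset_zero (s := hfin.toFinset) (by
          intro P hP
          refine M.proj_proj_of_disjoint (LFCMSpace.meas_of_mem_partition P.2) hA ?_ z
          rw [Set.disjoint_iff_inter_eq_empty, ← Set.not_nonempty_iff_eq_empty]
          simpa using hP)
      rwa [hsum] at this
    | zero => simp
    | add v w _ _ hv hw => simpa using hv.add hw
    | smul c v _ hv => simpa using hv.const_smul c
  rw [HasSum, SummationFilter.unconditional_filter, Metric.tendsto_atTop]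
  intro ε hε
  obtain ⟨v, hv, hxv⟩ := Metric.dense_iff.1 M.nondeg x (ε / 3) (by positivity)
  have hvs := hspan v hxv
  rw [HasSum, SummationFilter.unconditional_filter, Metric.tendsto_atTop] at hvs
  obtain ⟨s₀, hs₀⟩ := hvs (ε / 3) (by positivity)
  refine ⟨s₀, fun s hs => ?_⟩
  have h1 := hs₀ s hs
  have h2 : ‖M.proj (⋃ P ∈ s, (P : Set X)) (x - v)‖ ≤ ‖x - v‖ :=
    M.norm_proj_apply_le (biUnion_meas s) _
  rw [← M.proj_biUnion, dist_eq_norm] at h1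
  rw [Metric.mem_ball, dist_comm, dist_eq_norm] at hv
  rw [← M.proj_biUnion, dist_eq_norm]
  have h3 : M.proj (⋃ P ∈ s, (P : Set X)) x - x =
      M.proj (⋃ P ∈ s, (P : Set X)) (x - v) + (M.proj (⋃ P ∈ s, (P : Set X)) v - v) - (x - v) := by
    rw [map_sub]; abel
  rw [h3]
  calc _ ≤ ‖M.proj (⋃ P ∈ s, (P : Set X)) (x - v)‖ + ‖M.proj (⋃ P ∈ s, (P : Set X)) v - v‖
        + ‖x - v‖ := (norm_sub_le _ _).trans (by gcongr; exact norm_add_le _ _)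
    _ < ε := by linarith

theorem exists_proj_inter_ne_zero {A : Set X} (hA : A ∈ 𝒳.meas) {x : H₁}
    (h : M.proj A x ≠ 0) : ∃ P ∈ 𝒳.partition, M.proj (P ∩ A) x ≠ 0 := by
  by_contra! hc
  refine h ((M.hasSum_proj_partition (M.proj A x)).unique ?_)
  have : (fun P : 𝒳.partition => M.proj P (M.proj A x)) = fun _ => 0 := by
    funext P
    rw [M.proj_proj (LFCMSpace.meas_of_mem_partition P.2) hA]
    exact hc P P.2
  rw [this]
  exact hasSum_zero

end CoarseModule

theorem one_le_projRank_iff [NormedAddCommGroup H₁] [InnerProductSpace ℂ H₁]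
    (t : H₁ →L[ℂ] H₁) : 1 ≤ projRank t ↔ t ≠ 0 := by
  unfold projRank
  rw [Cardinal.one_le_iff_ne_zero, LinearMap.rank, ne_eq, Submodule.rank_eq_zero,
    LinearMap.range_eq_bot]
  exact not_congr ⟨fun h => ContinuousLinearMap.ext fun x => LinearMap.congr_fun h x,
    fun h => by rw [h]; rfl⟩

theorem proj_comp_comp_proj_eq_zero [NormedAddCommGroup H₁] [InnerProductSpace ℂ H₁]
    [CompleteSpace H₁] [NormedAddCommGroup H₂] [InnerProductSpace ℂ H₂] [CompleteSpace H₂]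
    {𝒳 : LFCMSpace X} {𝒴 : LFCMSpace Y} (CX : CoarseModule 𝒳 H₁) (CY : CoarseModule 𝒴 H₂)
    (s : H₁ →L[ℂ] H₂) {B : Set Y} {A : Set X} (hB : B ∈ 𝒴.meas) (hA : A ∈ 𝒳.meas)
    (h : ∀ y ∈ B, ∀ x ∈ A, (y, x) ∉ opSupp 𝒳 𝒴 CX.proj CY.proj s) (v : H₁) :
    CY.proj B (s (CX.proj A v)) = 0 := by
  have hPQ : ∀ P ∈ 𝒴.partition, ∀ Q ∈ 𝒳.partition,
      CY.proj (P ∩ B) ∘L s ∘L CX.proj (Q ∩ A) = 0 := by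
    intro P hP Q hQ
    by_contra hne
    rcases Set.eq_empty_or_nonempty (P ∩ B) with he | ⟨y, hyP, hyB⟩
    · exact hne (by rw [he, CY.proj_empty, ContinuousLinearMap.zero_comp])
    rcases Set.eq_empty_or_nonempty (Q ∩ A) with he | ⟨x, hxQ, hxA⟩
    · exact hne (by
        rw [he, CX.proj_empty, ContinuousLinearMap.comp_zero, ContinuousLinearMap.comp_zero])
    refine h y hyB x hxA ⟨(P ∩ B) ×ˢ (Q ∩ A), ⟨P ∩ B, Q ∩ A, rfl,
      LFCMSpace.inter_mem (LFCMSpace.meas_of_mem_partition hP) hB, ?_,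
      LFCMSpace.inter_mem (LFCMSpace.meas_of_mem_partition hQ) hA, ?_, hne⟩,
      ⟨hyP, hyB⟩, ⟨hxQ, hxA⟩⟩
    · exact (Set.prod_mono Set.inter_subset_left Set.inter_subset_left).trans
        (LFCMSpace.prod_subset_disc hP)
    · exact (Set.prod_mono Set.inter_subset_left Set.inter_subset_left).trans
        (LFCMSpace.prod_subset_disc hQ)
  by_contra hne
  obtain ⟨P, hP, hne⟩ := CY.exists_proj_inter_ne_zero hB hne
  refine hne ?_
  have h1 := (CX.hasSum_proj_partition (CX.proj A v)).mapL (CY.proj (P ∩ B) ∘L s)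
  refine h1.unique ?_
  have : (fun Q : 𝒳.partition => (CY.proj (P ∩ B) ∘L s) (CX.proj Q (CX.proj A v))) =
      fun _ => 0 := by
    funext Q
    rw [CX.proj_proj (LFCMSpace.meas_of_mem_partition Q.2) hA]
    exact DFunLike.congr_fun (hPQ P hP Q Q.2) v
  rw [this]
  exact hasSum_zero

section WeaklyAdditive

variable [NormedAddCommGroup H₁] [InnerProductSpace ℂ H₁]

/-- A family of operators indexed by the subsets of `ι` is weakly countably additive. -/
def WeaklyAdditive {ι : Type} (T : (ι → Bool) → (H₁ →L[ℂ] H₁)) : Prop :=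
  ∀ x y : H₁, ∃ f : ι → ℂ, Summable f ∧
    ∀ b, inner ℂ y (T b x) = ∑' i, if b i = true then f i else 0

theorem WeaklyAdditive.continuous_inner {ι : Type} {T : (ι → Bool) → (H₁ →L[ℂ] H₁)}
    (hT : WeaklyAdditive T) (x y : H₁) : Continuous fun b => inner ℂ y (T b x) := by
  obtain ⟨f, hf, hfT⟩ := hT x y
  simp_rw [hfT]
  refine continuous_tsum (u := fun i => ‖f i‖) (fun i => ?_) hf.norm fun i b => ?_
  · exact (continuous_of_discreteTopology (f := fun c : Bool => if c = true then f i else 0)).comp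
      (continuous_apply i)
  · split_ifs <;> simp

theorem summable_ite_bool {ι : Type} {f : ι → ℂ} (hf : Summable f) (b : ι → Bool) :
    Summable fun i => if b i = true then f i else 0 := by
  refine Summable.of_norm_bounded hf.norm fun i => ?_
  split_ifs <;> simp

theorem WeaklyAdditive.eq_add_sub {ι : Type} {T : (ι → Bool) → (H₁ →L[ℂ] H₁)}
    (hT : WeaklyAdditive T) {b b₁ b₂ b₃ : ι → Bool}
    (h : ∀ i, ((if b i = true then 1 else 0 : ℂ)) =
      (if b₁ i = true then 1 else 0) + (if b₂ i = true then 1 else 0)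
        - (if b₃ i = true then 1 else 0)) :
    T b = T b₁ + T b₂ - T b₃ := by
  ext x
  refine ext_inner_left ℂ fun y => ?_
  obtain ⟨f, hf, hfT⟩ := hT x y
  rw [sub_apply, add_apply, inner_sub_right,
    inner_add_right, hfT, hfT, hfT, hfT,
    ← (summable_ite_bool hf b₁).tsum_add (summable_ite_bool hf b₂),
    ← ((summable_ite_bool hf b₁).add (summable_ite_bool hf b₂)).tsum_sub (summable_ite_bool hf b₃)]
  refine tsum_congr fun i => ?_
  have h' : ∀ c : Bool, (if c = true then f i else 0) = (if c = true then 1 else 0 : ℂ) * f i := by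
    intro c; split_ifs <;> simp
  rw [h', h', h', h', h i]
  ring

end WeaklyAdditive

section QuasiLocal

variable [NormedAddCommGroup H₁] [InnerProductSpace ℂ H₁] [CompleteSpace H₁]
variable {𝒳 : LFCMSpace X} (M : CoarseModule 𝒳 H₁)

/-- An operator `t` is `ε`-`F`-quasi-local if `‖1_{B'} t 1_B‖ ≤ ε` for all measurable `B'`, `B`
such that `B' × B` is disjoint from `F`; the norm bound is expressed by matrix coefficients. -/
def QuasiLocal (F : Set (X × X)) (ε : ℝ) (t : H₁ →L[ℂ] H₁) : Prop :=
  ∀ B' ∈ 𝒳.meas, ∀ B ∈ 𝒳.meas, (∀ y ∈ B', ∀ x ∈ B, (y, x) ∉ F) →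
    ∀ x y : H₁, ‖inner ℂ (M.proj B' y) (t (M.proj B x))‖ ≤ ε * (‖x‖ * ‖y‖)

namespace QuasiLocal

variable {M} {F F' : Set (X × X)} {ε ε' : ℝ} {t t' : H₁ →L[ℂ] H₁}

theorem mono (h : QuasiLocal M F ε t) (hF : F ⊆ F') : QuasiLocal M F' ε t :=
  fun B' hB' B hB hd => h B' hB' B hB fun y hy x hx hyx => hd y hy x hx (hF hyx)

theorem add (h : QuasiLocal M F ε t) (h' : QuasiLocal M F ε' t') :
    QuasiLocal M F (ε + ε') (t + t') := by
  intro B' hB' B hB hd x y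
  have h1 := h B' hB' B hB hd x y
  have h2 := h' B' hB' B hB hd x y
  rw [add_apply, inner_add_right]
  refine (norm_add_le _ _).trans ?_
  linarith

theorem sub (h : QuasiLocal M F ε t) (h' : QuasiLocal M F ε' t') :
    QuasiLocal M F (ε + ε') (t - t') := by
  intro B' hB' B hB hd x y
  have h1 := h B' hB' B hB hd x y
  have h2 := h' B' hB' B hB hd x y
  rw [sub_apply, inner_sub_right]
  refine (norm_sub_le _ _).trans ?_
  linarith

theorem norm_proj_le (h : QuasiLocal M F ε t) {B' B : Set X} (hB' : B' ∈ 𝒳.meas)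
    (hB : B ∈ 𝒳.meas) (hd : ∀ y ∈ B', ∀ x ∈ B, (y, x) ∉ F) (x : H₁) :
    ‖M.proj B' (t (M.proj B x))‖ ≤ ε * ‖x‖ := by
  rcases eq_or_lt_of_le (norm_nonneg (M.proj B' (t (M.proj B x)))) with h0 | h0
  · rw [← h0]
    by_contra! hneg
    have hx : 0 < ‖x‖ := by
      rcases eq_or_lt_of_le (norm_nonneg x) with h | h
      · rw [← h, mul_zero] at hneg; exact absurd hneg (lt_irrefl _)
      · exact h
    have := h B' hB' B hB hd x x
    have h2 : ε * (‖x‖ * ‖x‖) < 0 := by nlinarith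
    linarith [norm_nonneg (inner ℂ (M.proj B' x) (t (M.proj B x)))]
  · have h1 := h B' hB' B hB hd x (M.proj B' (t (M.proj B x)))
    rw [M.inner_proj_left hB', inner_self_eq_norm_sq_to_K] at h1
    simp only [norm_pow, Complex.coe_algebraMap, Complex.norm_real, norm_norm] at h1
    refine le_of_mul_le_mul_right ?_ h0
    linarith

end QuasiLocal

variable {M}

theorem Approximable.exists_quasiLocal {t : H₁ →L[ℂ] H₁} (h : Approximable 𝒳 M.proj M.proj t)
    {ε : ℝ} (hε : 0 < ε) : ∃ F ∈ 𝒳.coarse.entourages, QuasiLocal M F ε t := by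
  obtain ⟨s, hs, hts⟩ := h ε hε
  refine ⟨_, hs, ?_⟩
  intro B' hB' B hB hd x y
  have h0 := proj_comp_comp_proj_eq_zero M M s hB' hB hd x
  have h1 : inner ℂ (M.proj B' y) (t (M.proj B x)) =
      inner ℂ (M.proj B' y) ((t - s) (M.proj B x)) := by
    rw [sub_apply, inner_sub_right, M.inner_proj_left hB' y (s _), h0]
    simp
  rw [h1]
  calc _ ≤ ‖M.proj B' y‖ * ‖(t - s) (M.proj B x)‖ := norm_inner_le_norm _ _
    _ ≤ ‖y‖ * (ε * ‖x‖) := by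
        gcongr
        · exact M.norm_proj_apply_le hB' y
        · refine ((t - s).le_of_opNorm_le hts _).trans ?_
          gcongr
          exact M.norm_proj_apply_le hB x
    _ = _ := by ring

/-- Uniformization: a weakly countably additive family of approximable operators is uniformly
quasi-local. -/
theorem WeaklyAdditive.exists_quasiLocal {ι : Type} {T : (ι → Bool) → (H₁ →L[ℂ] H₁)}
    (hT : WeaklyAdditive T) (hX : 𝒳.coarse.IsCountablyGenerated)
    (happ : ∀ b, Approximable 𝒳 M.proj M.proj (T b)) {ε : ℝ} (hε : 0 < ε) :
    ∃ F ∈ 𝒳.coarse.entourages, ∀ b, QuasiLocal M F ε (T b) := by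
  classical
  obtain ⟨F, -, hFC, hF⟩ := 𝒳.coarse.exists_monotone_cofinal hX
  have hε3 : 0 < ε / 3 := by positivity
  have hclosed : ∀ n, IsClosed {b | QuasiLocal M (F n) (ε / 3) (T b)} := by
    intro n
    simp only [QuasiLocal, Set.ofPred_forall]
    refine isClosed_iInter fun B' => isClosed_iInter fun _ => isClosed_iInter fun B =>
      isClosed_iInter fun _ => isClosed_iInter fun _ => isClosed_iInter fun x =>
      isClosed_iInter fun y => ?_
    exact isClosed_le (hT.continuous_inner _ _).norm continuous_const
  have hcover : ⋃ n, {b | QuasiLocal M (F n) (ε / 3) (T b)} = Set.univ := by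
    refine Set.eq_univ_of_forall fun b => ?_
    obtain ⟨E, hE, hEb⟩ := (happ b).exists_quasiLocal hε3
    obtain ⟨n, hn⟩ := hF E hE
    exact Set.mem_iUnion.2 ⟨n, hEb.mono hn⟩
  obtain ⟨n, b₀, hb₀⟩ := nonempty_interior_of_iUnion_of_closed hclosed hcover
  obtain ⟨J, u, hu, hJ⟩ := isOpen_pi_iff.1 isOpen_interior b₀ hb₀
  have hcyl : ∀ b : ι → Bool, (∀ i ∈ J, b i = b₀ i) → QuasiLocal M (F n) (ε / 3) (T b) := by
    intro b hb
    have : b ∈ (J : Set ι).pi u := fun i hi => by rw [hb i hi]; exact (hu i hi).2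
    exact interior_subset (hJ this)
  choose G hGC hG using fun b => (happ b).exists_quasiLocal hε3
  let ext : Finset ι → ι → Bool := fun s i => decide (i ∈ s)
  refine ⟨F n ∪ ⋃ s ∈ J.powerset, G (ext s), 𝒳.coarse.union_mem (hFC n)
    (𝒳.coarse.biUnion_finset_mem _ _ fun s _ => hGC _), fun b => ?_⟩
  have hb : T b = T (ext (J.filter fun i => b i = true)) +
      T (fun i => if i ∈ J then b₀ i else b i) - T (fun i => if i ∈ J then b₀ i else false) := by
    refine hT.eq_add_sub fun i => ?_
    by_cases hi : i ∈ J <;> simp [ext, hi]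
  rw [hb, show ε = ε / 3 + ε / 3 + ε / 3 by ring]
  refine ((hG _).mono ?_).add ((hcyl _ ?_).mono Set.subset_union_left) |>.sub
    ((hcyl _ ?_).mono Set.subset_union_left)
  · refine Set.Subset.trans ?_ Set.subset_union_right
    exact Set.subset_biUnion_of_mem (u := fun s => G (ext s))
      (Finset.mem_coe.2 (Finset.mem_powerset.2 (Finset.filter_subset _ J)))
  · intro i hi; simp [hi]
  · intro i hi; simp [hi]

end QuasiLocal

theorem Orthonormal.exists_sum_rankOne [NormedAddCommGroup H₁] [InnerProductSpace ℂ H₁]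
    [CompleteSpace H₁] {ι : Type} {e e' : ι → H₁} (he : Orthonormal ℂ e)
    (he' : Orthonormal ℂ e') :
    ∃ S : (ι → Bool) → (H₁ →L[ℂ] H₁), ∀ x y : H₁,
      Summable (fun i => (inner ℂ y (e' i) * inner ℂ (e i) x : ℂ)) ∧
      ∀ b, inner ℂ y (S b x) =
        ∑' i, if b i = true then (inner ℂ y (e' i) * inner ℂ (e i) x : ℂ) else 0 := by
  classical
  let V := fun b : ι → Bool => (he.comp (Subtype.val : {i // b i = true} → ι)
    Subtype.val_injective).orthogonalFamily.linearIsometry.toContinuousLinearMap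
  let V' := fun b : ι → Bool => (he'.comp (Subtype.val : {i // b i = true} → ι)
    Subtype.val_injective).orthogonalFamily.linearIsometry.toContinuousLinearMap
  have hV : ∀ b (i : {i // b i = true}) x,
      (ContinuousLinearMap.adjoint (V b) x : ∀ _ : {i // b i = true}, ℂ) i
        = inner ℂ (e i) x := by
    intro b i x
    have h := lp.inner_single_left (𝕜 := ℂ) i (1 : ℂ) (ContinuousLinearMap.adjoint (V b) x)
    rw [ContinuousLinearMap.adjoint_inner_right] at h
    have h2 : V b (lp.single 2 i (1 : ℂ)) = e i := by
      refine ((he.comp (Subtype.val : {i // b i = true} → ι)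
        Subtype.val_injective).orthogonalFamily.linearIsometry_apply_single _).trans ?_
      simp
    rw [h2] at h
    rw [h]; simp
  have hV' : ∀ b (i : {i // b i = true}) x,
      (ContinuousLinearMap.adjoint (V' b) x : ∀ _ : {i // b i = true}, ℂ) i
        = inner ℂ (e' i) x := by
    intro b i x
    have h := lp.inner_single_left (𝕜 := ℂ) i (1 : ℂ) (ContinuousLinearMap.adjoint (V' b) x)
    rw [ContinuousLinearMap.adjoint_inner_right] at h
    have h2 : V' b (lp.single 2 i (1 : ℂ)) = e' i := by
      refine ((he'.comp (Subtype.val : {i // b i = true} → ι)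
        Subtype.val_injective).orthogonalFamily.linearIsometry_apply_single _).trans ?_
      simp
    rw [h2] at h
    rw [h]; simp
  refine ⟨fun b => V' b ∘L ContinuousLinearMap.adjoint (V b), fun x y => ⟨?_, fun b => ?_⟩⟩
  · refine Summable.of_norm_bounded
      ((he'.inner_products_summable y).add (he.inner_products_summable x)) fun i => ?_
    rw [norm_mul, norm_inner_symm y]
    nlinarith [sq_nonneg (‖(inner ℂ (e' i) y : ℂ)‖ - ‖(inner ℂ (e i) x : ℂ)‖),
      sq_nonneg ‖(inner ℂ (e' i) y : ℂ)‖, sq_nonneg ‖(inner ℂ (e i) x : ℂ)‖]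
  · rw [ContinuousLinearMap.comp_apply, ← ContinuousLinearMap.adjoint_inner_left,
      lp.inner_eq_tsum]
    have : (fun i => if b i = true then (inner ℂ y (e' i) * inner ℂ (e i) x : ℂ) else 0) =
        Set.indicator {i | b i = true} fun i => (inner ℂ y (e' i) * inner ℂ (e i) x : ℂ) := by
      funext i; simp [Set.indicator_apply]
    rw [this, ← tsum_subtype]
    refine tsum_congr fun i => ?_
    rw [hV' b i, hV b i, RCLike.inner_apply, inner_conj_symm, mul_comm]

theorem WeaklyAdditive.conj [NormedAddCommGroup H₁] [InnerProductSpace ℂ H₁] [CompleteSpace H₁]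
    [NormedAddCommGroup H₂] [InnerProductSpace ℂ H₂] [CompleteSpace H₂] {ι : Type}
    {T : (ι → Bool) → (H₁ →L[ℂ] H₁)} (hT : WeaklyAdditive T) (V : H₁ →L[ℂ] H₂) :
    WeaklyAdditive fun b => V ∘L T b ∘L ContinuousLinearMap.adjoint V := by
  intro x y
  obtain ⟨f, hf, hfT⟩ := hT (ContinuousLinearMap.adjoint V x) (ContinuousLinearMap.adjoint V y)
  refine ⟨f, hf, fun b => ?_⟩
  rw [← hfT, ContinuousLinearMap.adjoint_inner_left]
  rfl

theorem CoarseModule.approximable_of_inner_eq_tsum [NormedAddCommGroup H₁]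
    [InnerProductSpace ℂ H₁] [CompleteSpace H₁] {𝒳 : LFCMSpace X} (M : CoarseModule 𝒳 H₁)
    {ι : Type} {E : Set (X × X)} (hE : E ∈ 𝒳.coarse.entourages) {K : ι → Set X}
    (hK : ∀ i, K i ∈ 𝒳.meas) (hKE : ∀ i, K i ×ˢ K i ⊆ E) {a a' : ι → H₁}
    (ha : ∀ i, M.proj (K i) (a i) = a i) (ha' : ∀ i, M.proj (K i) (a' i) = a' i)
    (b : ι → Bool) {T : H₁ →L[ℂ] H₁}
    (hT : ∀ x y : H₁, inner ℂ y (T x) =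
      ∑' i, if b i = true then (inner ℂ y (a' i) * inner ℂ (a i) x : ℂ) else 0) :
    Approximable 𝒳 M.proj M.proj T := by
  intro ε hε
  refine ⟨T, ?_, by simpa using hε.le⟩
  refine 𝒳.coarse.mem_of_subset
    (𝒳.coarse.comp_mem 𝒳.disc_mem (𝒳.coarse.comp_mem hE 𝒳.disc_mem)) ?_
  rintro ⟨y, x⟩ ⟨_, ⟨B, A, rfl, hB, hBd, hA, hAd, hne⟩, hy, hx⟩
  by_contra hyx
  refine hne (ContinuousLinearMap.ext fun v => ext_inner_left ℂ fun w => ?_)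
  rw [zero_apply, inner_zero_right, ContinuousLinearMap.comp_apply,
    ContinuousLinearMap.comp_apply, ← M.inner_proj_left hB, hT]
  have hz : ∀ i, (inner ℂ (M.proj B w) (a' i) * inner ℂ (a i) (M.proj A v) : ℂ) = 0 := by
    intro i
    by_cases hBi : Disjoint B (K i)
    · rw [← ha' i, M.inner_proj_left hB, M.proj_proj_of_disjoint hB (hK i) hBi]
      simp
    by_cases hAi : Disjoint A (K i)
    · rw [← ha i, ← M.inner_proj_left hA, M.proj_proj_of_disjoint hA (hK i) hAi]
      simp
    obtain ⟨p, hpB, hpK⟩ := Set.not_disjoint_iff.1 hBi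
    obtain ⟨q, hqA, hqK⟩ := Set.not_disjoint_iff.1 hAi
    exact absurd ⟨p, hBd ⟨hy, hpB⟩, q, hKE i ⟨hpK, hqK⟩, hAd ⟨hqA, hx⟩⟩ hyx
  simp [hz]

section Unitary

variable [NormedAddCommGroup H₁] [InnerProductSpace ℂ H₁] [CompleteSpace H₁]
variable [NormedAddCommGroup H₂] [InnerProductSpace ℂ H₂] [CompleteSpace H₂]
variable {𝒳 : LFCMSpace X} {𝒴 : LFCMSpace Y}
variable {CX : CoarseModule 𝒳 H₁} {CY : CoarseModule 𝒴 H₂} {U : H₁ →L[ℂ] H₂}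

/-- Conjugation by `U` maps approximable operators to approximable operators. -/
def AdApproximable (CX : CoarseModule 𝒳 H₁) (CY : CoarseModule 𝒴 H₂) (U : H₁ →L[ℂ] H₂) : Prop :=
  ∀ t : H₁ →L[ℂ] H₁, Approximable 𝒳 CX.proj CX.proj t →
    Approximable 𝒴 CY.proj CY.proj (U ∘L t ∘L ContinuousLinearMap.adjoint U)

theorem AdApproximable.norm_proj_mul_norm_proj_le
    [NormedAddCommGroup H₃] [InnerProductSpace ℂ H₃] [CompleteSpace H₃]
    (hAd : AdApproximable CX CY U) (hY : 𝒴.coarse.IsCountablyGenerated)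
    {ι : Type} {E : Set (X × X)} (hE : E ∈ 𝒳.coarse.entourages) {K : ι → Set X}
    (hK : ∀ i, K i ∈ 𝒳.meas) (hKE : ∀ i, K i ×ˢ K i ⊆ E) {e e' : ι → H₃}
    (he : Orthonormal ℂ e) (he' : Orthonormal ℂ e') (V : H₃ →L[ℂ] H₁)
    (hV : ∀ i, CX.proj (K i) (V (e i)) = V (e i))
    (hV' : ∀ i, CX.proj (K i) (V (e' i)) = V (e' i)) {ε : ℝ} (hε : 0 < ε) :
    ∃ F ∈ 𝒴.coarse.entourages, ∀ i, ∀ B' ∈ 𝒴.meas, ∀ B ∈ 𝒴.meas,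
      (∀ y ∈ B', ∀ x ∈ B, (y, x) ∉ F) →
        ‖CY.proj B' (U (V (e' i)))‖ * ‖CY.proj B (U (V (e i)))‖ ≤ ε := by
  classical
  obtain ⟨S, hS⟩ := he.exists_sum_rankOne he'
  have hSw : WeaklyAdditive S := fun x y => ⟨_, (hS x y).1, (hS x y).2⟩
  have hV2 : ∀ b x y, inner ℂ y ((V ∘L S b ∘L ContinuousLinearMap.adjoint V) x) =
      ∑' i, if b i = true then (inner ℂ y (V (e' i)) * inner ℂ (V (e i)) x : ℂ) else 0 := by
    intro b x y
    rw [ContinuousLinearMap.comp_apply, ← ContinuousLinearMap.adjoint_inner_left,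
      ContinuousLinearMap.comp_apply, (hS _ _).2]
    simp_rw [ContinuousLinearMap.adjoint_inner_left, ContinuousLinearMap.adjoint_inner_right]
  obtain ⟨F, hF, hq⟩ := ((hSw.conj V).conj U).exists_quasiLocal (M := CY) hY (fun b =>
    hAd _ (CX.approximable_of_inner_eq_tsum hE hK hKE hV hV' b (hV2 b))) hε
  refine ⟨F, hF, fun i B' hB' B hB hd => ?_⟩
  set p := CY.proj B' (U (V (e' i)))
  set q := CY.proj B (U (V (e i)))
  have h := hq (fun j => decide (j = i)) B' hB' B hB hd q p
  rw [ContinuousLinearMap.comp_apply, ← ContinuousLinearMap.adjoint_inner_left,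
    ContinuousLinearMap.comp_apply, hV2] at h
  simp only [decide_eq_true_eq, tsum_ite_eq] at h
  rw [ContinuousLinearMap.adjoint_inner_left, ContinuousLinearMap.adjoint_inner_right,
    CY.proj_proj_of_subset hB' hB' subset_rfl, CY.proj_proj_of_subset hB hB subset_rfl,
    CY.inner_proj_left hB', ← CY.inner_proj_left hB'] at h
  rw [← CY.proj_proj_of_subset hB' hB' subset_rfl, CY.inner_proj_left hB' _ (U (V (e' i))),
    CY.inner_proj_self hB] at h
  rw [inner_self_eq_norm_sq_to_K] at h
  simp only [norm_mul, norm_pow, Complex.coe_algebraMap, Complex.norm_real, norm_norm] at h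
  by_contra! hlt
  change ‖p‖ ^ 2 * ‖q‖ ^ 2 ≤ ε * (‖q‖ * ‖p‖) at h
  nlinarith [mul_lt_mul_of_pos_right hlt (hε.trans hlt)]

end Unitary

namespace CoarseSpace

variable {C : CoarseSpace X}

theorem nbhd_prod_subset {E F : Set (X × X)} {A : Set X} (h : A ×ˢ A ⊆ F) :
    nbhd E A ×ˢ nbhd E A ⊆ RelComp E (RelComp F (RelTrans E)) := by
  rintro ⟨x, y⟩ ⟨⟨a, ha, hx⟩, b, hb, hy⟩
  exact ⟨a, hx, b, h ⟨ha, hb⟩, hy⟩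

theorem nbhd_conj_mem {E F : Set (X × X)} (hE : E ∈ C.entourages) (hF : F ∈ C.entourages) :
    RelComp E (RelComp F (RelTrans E)) ∈ C.entourages :=
  C.comp_mem hE (C.comp_mem hF (C.transpose_mem hE))

theorem IsBounded.nbhd {A : Set X} (h : C.IsBounded A) {E : Set (X × X)}
    (hE : E ∈ C.entourages) : C.IsBounded (nbhd E A) := by
  obtain ⟨F, hF, hAF⟩ := h
  exact ⟨_, nbhd_conj_mem hE hF, nbhd_prod_subset hAF⟩

end CoarseSpace

section Unitary

open CoarseSpace

variable [NormedAddCommGroup H₁] [InnerProductSpace ℂ H₁] [CompleteSpace H₁]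
variable [NormedAddCommGroup H₂] [InnerProductSpace ℂ H₂] [CompleteSpace H₂]
variable {𝒳 : LFCMSpace X} {𝒴 : LFCMSpace Y}
variable {CX : CoarseModule 𝒳 H₁} {CY : CoarseModule 𝒴 H₂} {U : H₁ →L[ℂ] H₂}

theorem orthonormal_of_proj_disjoint (M : CoarseModule 𝒳 H₁) {e : ℕ → H₁} {D : ℕ → Set X}
    (hD : ∀ n, D n ∈ 𝒳.meas) (hdisj : ∀ m n, m < n → Disjoint (D m) (D n))
    (he : ∀ n, ‖e n‖ = 1) (heD : ∀ n, M.proj (D n) (e n) = e n) : Orthonormal ℂ e := by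
  refine ⟨he, ?_⟩
  intro m n hmn
  have hd : Disjoint (D m) (D n) := by
    rcases lt_or_gt_of_ne hmn with h | h
    · exact hdisj _ _ h
    · exact (hdisj _ _ h).symm
  rw [← heD m, ← heD n, M.inner_proj_left (hD m), M.proj_proj_of_disjoint (hD m) (hD n) hd,
    inner_zero_right]

theorem exists_unit_of_proj_ne_zero (M : CoarseModule 𝒳 H₁) {D : Set X} (hD : D ∈ 𝒳.meas)
    {w : H₁} (hw : M.proj D w ≠ 0) :
    ∃ u : H₁, ‖u‖ = 1 ∧ M.proj D u = u ∧ M.proj D w = (‖M.proj D w‖ : ℂ) • u := by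
  have hn : (‖M.proj D w‖ : ℂ) ≠ 0 := by simpa using hw
  refine ⟨(‖M.proj D w‖ : ℂ)⁻¹ • M.proj D w, ?_, ?_, ?_⟩
  · rw [norm_smul, norm_inv, Complex.norm_real, norm_norm, inv_mul_cancel₀]
    simpa using hw
  · rw [map_smul, M.proj_proj_of_subset hD hD subset_rfl]
  · rw [smul_inv_smul₀ hn]

/-- Vectors in the module over a bounded set `K` are concentrated, after applying `U`, on
the neighbourhoods of any block seen by `U`. -/
theorem AdApproximable.exists_norm_proj_nbhd_compl_le (hAd : AdApproximable CX CY U)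
    {K : Set X} (hK : K ∈ 𝒳.meas) (hKb : 𝒳.coarse.IsBounded K) {v₀ : H₁} {Q : Set Y}
    (hQ : Q ∈ 𝒴.meas) (hv₀ : CY.proj Q (U (CX.proj K v₀)) ≠ 0) (v : H₁) {η : ℝ} (hη : 0 < η) :
    ∃ F ∈ 𝒴.coarse.entourages, ∀ W ∈ 𝒴.meas, nbhd F Q ⊆ W →
      ‖CY.proj Wᶜ (U (CX.proj K v))‖ ≤ η := by
  obtain ⟨E, hE, hKE⟩ := hKb
  set q := CY.proj Q (U (CX.proj K v₀)) with hq
  have hq0 : 0 < ‖q‖ := norm_pos_iff.2 hv₀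
  let t : H₁ →L[ℂ] H₁ := (innerSL ℂ (CX.proj K v₀)).smulRight (CX.proj K v)
  have ht : Approximable 𝒳 CX.proj CX.proj t := by
    refine CX.approximable_of_inner_eq_tsum (ι := Unit) hE (K := fun _ => K) (fun _ => hK)
      (fun _ => hKE) (a := fun _ => CX.proj K v₀) (a' := fun _ => CX.proj K v)
      (fun _ => CX.proj_proj_of_subset hK hK subset_rfl _)
      (fun _ => CX.proj_proj_of_subset hK hK subset_rfl _) (fun _ => true) ?_
    intro x y
    simp [t, mul_comm]
  obtain ⟨F, hF, hql⟩ := (hAd t ht).exists_quasiLocal (ε := η * ‖q‖) (by positivity)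
  refine ⟨F, hF, fun W hW hFW => ?_⟩
  have h := hql.norm_proj_le (𝒴.compl_mem hW) hQ
    (fun y hy x hx hyx => hy (hFW ⟨x, hx, hyx⟩)) q
  have h2 : (U ∘L t ∘L ContinuousLinearMap.adjoint U) (CY.proj Q q) =
      ((‖q‖ : ℂ) ^ 2) • U (CX.proj K v) := by
    have : inner ℂ (CX.proj K v₀) (ContinuousLinearMap.adjoint U (CY.proj Q q)) =
        (‖q‖ : ℂ) ^ 2 := by
      rw [ContinuousLinearMap.adjoint_inner_right, ← CY.inner_proj_left hQ, ← hq,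
        inner_self_eq_norm_sq_to_K]
      rfl
    simp [t, this]
  rw [h2, map_smul, norm_smul, norm_pow, Complex.norm_real, norm_norm] at h
  have h3 : ‖q‖ ^ 2 * ‖CY.proj Wᶜ (U (CX.proj K v))‖ ≤ ‖q‖ ^ 2 * η := by linarith
  exact le_of_mul_le_mul_left h3 (by positivity)

/-- If `K` is bounded then `U 1_K` is, up to `ε`, concentrated on a bounded set. -/
theorem AdApproximable.exists_isBounded_norm_proj_compl_le (hAd : AdApproximable CX CY U)
    (hY : 𝒴.coarse.IsCountablyGenerated) {K : Set X} (hK : K ∈ 𝒳.meas)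
    (hKb : 𝒳.coarse.IsBounded K) {ε : ℝ} (hε : 0 < ε) :
    ∃ W ∈ 𝒴.meas, 𝒴.coarse.IsBounded W ∧
      ∀ v, ‖CY.proj Wᶜ (U (CX.proj K v))‖ ≤ ε * ‖v‖ := by
  by_contra! hcon
  obtain ⟨v₀, hv₀⟩ := hcon ∅ 𝒴.empty_mem ⟨_, 𝒴.coarse.diagonal_mem, by simp⟩
  rw [Set.compl_empty] at hv₀
  have hv₀' : CY.proj Set.univ (U (CX.proj K v₀)) ≠ 0 := by
    rw [← norm_pos_iff]
    exact lt_of_le_of_lt (by positivity) hv₀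
  obtain ⟨Q, hQ, hQv⟩ := CY.exists_proj_inter_ne_zero 𝒴.univ_mem hv₀'
  rw [Set.inter_univ] at hQv
  have hQm := LFCMSpace.meas_of_mem_partition hQ
  have hQb : 𝒴.coarse.IsBounded Q := ⟨_, 𝒴.disc_mem, LFCMSpace.prod_subset_disc hQ⟩
  obtain ⟨F, hFmono, hFC, hF⟩ := 𝒴.coarse.exists_monotone_cofinal hY
  let W : ℕ → Set Y := fun k => nbhd 𝒴.disc (nbhd (F k) Q)
  have hWm : ∀ k, W k ∈ 𝒴.meas := fun k => LFCMSpace.nbhd_disc_meas _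
  have hWb : ∀ k, 𝒴.coarse.IsBounded (W k) := fun k => (hQb.nbhd (hFC k)).nbhd 𝒴.disc_mem
  have hWmono : Monotone W := by
    rintro k l hkl y ⟨z, ⟨a, ha, hz⟩, hy⟩
    exact ⟨z, ⟨a, ha, hFmono hkl hz⟩, hy⟩
  have hstep : ∀ k, ∃ l, ∃ u : H₂, k < l ∧ ‖u‖ = 1 ∧ CY.proj (W l ∩ (W k)ᶜ) u = u ∧
      ε / 2 < ‖CX.proj K (ContinuousLinearMap.adjoint U u)‖ ∧
      ∀ y, ∀ x ∈ W k, (y, x) ∈ F k → y ∈ W l := by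
    intro k
    obtain ⟨v, hv⟩ := hcon (W k) (hWm k) (hWb k)
    set w := U (CX.proj K v) with hw
    have hpos : 0 < ‖CY.proj (W k)ᶜ w‖ := lt_of_le_of_lt (by positivity) hv
    obtain ⟨E₁, hE₁, hE₁W⟩ := hAd.exists_norm_proj_nbhd_compl_le hK hKb hQm hQv v
      (half_pos hpos)
    obtain ⟨l₁, hl₁⟩ := hF E₁ hE₁
    obtain ⟨l₂, hl₂⟩ := hF _ (𝒴.coarse.comp_mem (hFC k) (𝒴.coarse.comp_mem 𝒴.disc_mem (hFC k)))
    obtain ⟨l, hl1, hl2, hkl⟩ : ∃ l, l₁ ≤ l ∧ l₂ ≤ l ∧ k < l :=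
      ⟨max (max l₁ l₂) (k + 1), by simp, by simp, by simp⟩
    have hD : W l ∩ (W k)ᶜ ∈ 𝒴.meas := LFCMSpace.inter_mem (hWm l) (𝒴.compl_mem (hWm k))
    have hWl : ‖CY.proj (W l)ᶜ w‖ ≤ ‖CY.proj (W k)ᶜ w‖ / 2 := by
      refine hE₁W _ (hWm l) ?_
      rintro y ⟨a, ha, hya⟩
      exact LFCMSpace.subset_nbhd_disc _ ⟨a, ha, hFmono hl1 (hl₁ hya)⟩
    have hpy := CY.norm_sq_proj_add (hWm l) (CY.proj (W k)ᶜ w)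
    rw [CY.proj_proj (hWm l) (𝒴.compl_mem (hWm k)),
      CY.proj_proj_of_subset (𝒴.compl_mem (hWm l)) (𝒴.compl_mem (hWm k))
        (Set.compl_subset_compl.2 (hWmono hkl.le))] at hpy
    have hDw : ‖CY.proj (W k)ᶜ w‖ / 2 < ‖CY.proj (W l ∩ (W k)ᶜ) w‖ := by
      refine lt_of_pow_lt_pow_left₀ 2 (norm_nonneg _) ?_
      nlinarith [norm_nonneg (CY.proj (W l)ᶜ w)]
    obtain ⟨u, hu1, hu2, hu3⟩ := exists_unit_of_proj_ne_zero CY hD (w := w)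
      (norm_pos_iff.1 (by linarith))
    refine ⟨l, u, hkl, hu1, hu2, ?_, ?_⟩
    · have h1 : inner ℂ (CX.proj K (ContinuousLinearMap.adjoint U u)) v =
          (‖CY.proj (W l ∩ (W k)ᶜ) w‖ : ℂ) := by
        rw [CX.inner_proj_left hK, ContinuousLinearMap.adjoint_inner_left, ← hw]
        conv_lhs =>
          rw [← hu2, CY.inner_proj_left hD, hu3, inner_smul_right, inner_self_eq_norm_sq_to_K, hu1]
        simp
      have h2 := norm_inner_le_norm (𝕜 := ℂ) (CX.proj K (ContinuousLinearMap.adjoint U u)) v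
      rw [h1, Complex.norm_real, norm_norm] at h2
      by_contra! hle
      have := mul_le_mul_of_nonneg_right hle (norm_nonneg v)
      linarith
    · rintro y x ⟨z, ⟨a, ha, hza⟩, hxz⟩ hyx
      exact LFCMSpace.subset_nbhd_disc _
        ⟨a, ha, hFmono hl2 (hl₂ ⟨x, hyx, z, hxz, hza⟩)⟩
  choose l u hl hu1 huD huK hlF using hstep
  let κ : ℕ → ℕ := fun n => l^[n] 0
  have hκs : ∀ n, κ (n + 1) = l (κ n) := fun n => Function.iterate_succ_apply' l n 0
  have hκ : StrictMono κ := strictMono_nat_of_lt_succ fun n => by rw [hκs]; exact hl _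
  let e : ℕ → H₂ := fun n => u (κ n)
  let D : ℕ → Set Y := fun n => W (κ (n + 1)) ∩ (W (κ n))ᶜ
  have hDm : ∀ n, D n ∈ 𝒴.meas := fun n =>
    LFCMSpace.inter_mem (hWm _) (𝒴.compl_mem (hWm _))
  have heD : ∀ n, CY.proj (D n) (e n) = e n := fun n => by
    change CY.proj (W (κ (n + 1)) ∩ (W (κ n))ᶜ) (u (κ n)) = u (κ n)
    rw [hκs]; exact huD _
  have he : Orthonormal ℂ e := by
    refine orthonormal_of_proj_disjoint CY hDm ?_ (fun n => hu1 _) heD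
    intro m n hmn
    refine Set.disjoint_left.2 fun y hy hy' => hy'.2 ?_
    exact hWmono (hκ.monotone hmn) hy.1
  have he' : Orthonormal ℂ fun n => e (n + 2) :=
    he.comp (fun n => n + 2) (add_left_injective 2)
  obtain ⟨E, hE, hKE⟩ := hKb
  have hpp : ∀ x, CX.proj K (CX.proj K x) = CX.proj K x :=
    CX.proj_proj_of_subset hK hK subset_rfl
  obtain ⟨F', hF', hprod⟩ := hAd.norm_proj_mul_norm_proj_le hY hE (K := fun _ : ℕ => K)
    (fun _ => hK) (fun _ => hKE) he he' (CX.proj K ∘L ContinuousLinearMap.adjoint U)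
    (fun _ => hpp _) (fun _ => hpp _) (ε := (ε / 2) ^ 4 / 2) (by positivity)
  have hlow : ∀ n, (ε / 2) ^ 2 ≤
      ‖CY.proj (D n) (U ((CX.proj K ∘L ContinuousLinearMap.adjoint U) (e n)))‖ := by
    intro n
    have h1 : inner ℂ (e n)
        (CY.proj (D n) (U ((CX.proj K ∘L ContinuousLinearMap.adjoint U) (e n)))) =
        (‖CX.proj K (ContinuousLinearMap.adjoint U (e n))‖ : ℂ) ^ 2 := by
      rw [← CY.inner_proj_left (hDm n), heD, ← ContinuousLinearMap.adjoint_inner_left,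
        ContinuousLinearMap.comp_apply, CX.inner_proj_self hK]
    have h2 := norm_inner_le_norm (𝕜 := ℂ) (e n)
      (CY.proj (D n) (U ((CX.proj K ∘L ContinuousLinearMap.adjoint U) (e n))))
    rw [h1, norm_pow, Complex.norm_real, norm_norm, he.1 n, one_mul] at h2
    refine le_trans ?_ h2
    have := huK (κ n)
    change ε / 2 < ‖CX.proj K (ContinuousLinearMap.adjoint U (e n))‖ at this
    gcongr
  obtain ⟨k, hk⟩ := hF F' hF'
  have hle := hprod k (D (k + 2)) (hDm _) (D k) (hDm _) (by
    intro y hy x hx hyx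
    refine hy.2 ?_
    rw [hκs (k + 1)]
    refine hlF _ y x hx.1 (hFmono ?_ (hk hyx))
    exact (Nat.le_succ k).trans (hκ.le_apply))
  have h1 := hlow k
  have h2 := hlow (k + 2)
  have h3 : (ε / 2) ^ 2 * (ε / 2) ^ 2 ≤ (ε / 2) ^ 4 / 2 :=
    (mul_le_mul h2 h1 (by positivity) (norm_nonneg _)).trans hle
  have h4 : 0 < (ε / 2) ^ 4 := by positivity
  have h5 : (ε / 2) ^ 2 * (ε / 2) ^ 2 = (ε / 2) ^ 4 := by ring
  linarith

end Unitary

section Rigidity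

open CoarseSpace

variable [NormedAddCommGroup H₁] [InnerProductSpace ℂ H₁] [CompleteSpace H₁]
variable [NormedAddCommGroup H₂] [InnerProductSpace ℂ H₂] [CompleteSpace H₂]
variable {𝒳 : LFCMSpace X} {𝒴 : LFCMSpace Y}
variable {CX : CoarseModule 𝒳 H₁} {CY : CoarseModule 𝒴 H₂} {U : H₁ →L[ℂ] H₂}

theorem exists_unit_of_lt_norm_comp (CX : CoarseModule 𝒳 H₁) (CY : CoarseModule 𝒴 H₂)
    {A : Set X} {B : Set Y} (hA : A ∈ 𝒳.meas) {δ : ℝ} (hδ : 0 < δ)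
    (h : δ < ‖CY.proj B ∘L U ∘L CX.proj A‖) :
    ∃ e : H₁, ‖e‖ = 1 ∧ CX.proj A e = e ∧ δ < ‖CY.proj B (U e)‖ := by
  obtain ⟨v, hv⟩ : ∃ v, δ * ‖v‖ < ‖CY.proj B (U (CX.proj A v))‖ := by
    by_contra! hc
    exact absurd (ContinuousLinearMap.opNorm_le_bound _ hδ.le hc) (not_le.2 h)
  have hne : CX.proj A v ≠ 0 := by
    intro h0
    rw [h0, map_zero, map_zero, norm_zero] at hv
    exact absurd hv (not_lt.2 (by positivity))
  obtain ⟨e, he1, he2, he3⟩ := exists_unit_of_proj_ne_zero CX hA hne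
  refine ⟨e, he1, he2, ?_⟩
  rw [he3, map_smul, map_smul, norm_smul, Complex.norm_real, norm_norm, mul_comm ‖CX.proj A v‖] at hv
  have h1 := mul_le_mul_of_nonneg_left (CX.norm_proj_apply_le hA v) hδ.le
  exact lt_of_mul_lt_mul_right (h1.trans_lt hv) (norm_nonneg _)

/-- Over sets of uniformly bounded size in `X`, the measurable sets on which the images of
unit vectors have mass at least `δ` are uniformly close to each other. -/
theorem AdApproximable.exists_entourage_of_norm_proj_lt (hAd : AdApproximable CX CY U)
    (hY : 𝒴.coarse.IsCountablyGenerated) {G : Set (X × X)} (hG : G ∈ 𝒳.coarse.entourages)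
    {δ : ℝ} (hδ : 0 < δ) :
    ∃ F ∈ 𝒴.coarse.entourages, ∀ K ∈ 𝒳.meas, K ×ˢ K ⊆ G → ∀ e e' : H₁,
      ‖e‖ = 1 → CX.proj K e = e → ‖e'‖ = 1 → CX.proj K e' = e' →
      ∀ B ∈ 𝒴.meas, ∀ B' ∈ 𝒴.meas, δ < ‖CY.proj B (U e)‖ → δ < ‖CY.proj B' (U e')‖ →
        ∃ y ∈ B', ∃ x ∈ B, (y, x) ∈ F := by
  classical
  by_contra! hcon
  obtain ⟨F, hFmono, hFC, hF⟩ := 𝒴.coarse.exists_monotone_cofinal hY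
  let K' : Set X → Set X := fun K => nbhd 𝒳.disc (nbhd G K)
  have hK'm : ∀ K, K' K ∈ 𝒳.meas := fun K => LFCMSpace.nbhd_disc_meas _
  have hW : ∀ K : Set X, K ×ˢ K ⊆ G → ∃ W ∈ 𝒴.meas, 𝒴.coarse.IsBounded W ∧
      ∀ v, ‖CY.proj Wᶜ (U (CX.proj (K' K) v))‖ ≤ δ * ‖v‖ := fun K hK =>
    hAd.exists_isBounded_norm_proj_compl_le hY (hK'm K)
      ((IsBounded.nbhd ⟨G, hG, hK⟩ hG).nbhd 𝒳.disc_mem) hδ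
  choose! W hWm hWb hWδ using hW
  obtain ⟨f, hfP, hfr⟩ := exists_seq_of_forall_finset_exists
    (fun a : ℕ × Set X × (H₁ × H₁) × (Set Y × Set Y) =>
      a.2.1 ∈ 𝒳.meas ∧ a.2.1 ×ˢ a.2.1 ⊆ G ∧
      (‖a.2.2.1.1‖ = 1 ∧ CX.proj a.2.1 a.2.2.1.1 = a.2.2.1.1) ∧
      (‖a.2.2.1.2‖ = 1 ∧ CX.proj a.2.1 a.2.2.1.2 = a.2.2.1.2) ∧
      a.2.2.2.1 ∈ 𝒴.meas ∧ a.2.2.2.2 ∈ 𝒴.meas ∧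
      δ < ‖CY.proj a.2.2.2.1 (U a.2.2.1.1)‖ ∧ δ < ‖CY.proj a.2.2.2.2 (U a.2.2.1.2)‖ ∧
      ∀ y ∈ a.2.2.2.2, ∀ x ∈ a.2.2.2.1, (y, x) ∉ F a.1)
    (fun a b => a.1 < b.1 ∧ Disjoint a.2.1 b.2.1) (by
      intro s hs
      obtain ⟨K, hK, hKG, e, e', he, hKe, he', hKe', B, hB, B', hB', hBe, hBe', hBB⟩ :=
        hcon (F (s.sup (fun a => a.1) + 1) ∪ ⋃ a ∈ s, W a.2.1 ×ˢ W a.2.1)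
          (𝒴.coarse.union_mem (hFC _) (𝒴.coarse.biUnion_finset_mem s _ (fun a ha => by
            obtain ⟨E, hE, hWE⟩ := hWb a.2.1 (hs a ha).2.1
            exact 𝒴.coarse.mem_of_subset hE hWE)))
      refine ⟨(s.sup (fun a => a.1) + 1, K, (e, e'), (B, B')),
        ⟨hK, hKG, ⟨he, hKe⟩, ⟨he', hKe'⟩, hB, hB', hBe, hBe',
          fun y hy x hx h => hBB y hy x hx (Or.inl h)⟩, fun a ha => ⟨?_, ?_⟩⟩
      · exact Nat.lt_succ_of_le (Finset.le_sup (f := fun a => a.1) ha)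
      · by_contra hd
        obtain ⟨z, hza, hzK⟩ := Set.not_disjoint_iff.1 hd
        have hKK : K ⊆ K' a.2.1 := fun x hx =>
          LFCMSpace.subset_nbhd_disc _ ⟨z, hza, hKG ⟨hx, hzK⟩⟩
        have haG := (hs a ha).2.1
        have hmeet : ∀ u : H₁, ‖u‖ = 1 → CX.proj K u = u → ∀ D ∈ 𝒴.meas,
            δ < ‖CY.proj D (U u)‖ → (D ∩ W a.2.1).Nonempty := by
          intro u hu1 hu2 D hD hDu
          by_contra hne
          have hDW : D ⊆ (W a.2.1)ᶜ := fun y hy hyW => hne ⟨y, hy, hyW⟩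
          have h1 := hWδ a.2.1 haG u
          rw [← hu2, CX.proj_proj_of_superset (hK'm _) hK hKK, hu2, hu1, mul_one] at h1
          have h2 := CY.norm_proj_apply_le hD (CY.proj (W a.2.1)ᶜ (U u))
          rw [CY.proj_proj_of_subset hD (𝒴.compl_mem (hWm _ haG)) hDW] at h2
          linarith
        obtain ⟨x, hxB, hxW⟩ := hmeet e he hKe B hB hBe
        obtain ⟨y, hyB, hyW⟩ := hmeet e' he' hKe' B' hB' hBe'
        exact hBB y hyB x hxB (Or.inr (Set.mem_biUnion ha ⟨hyW, hxW⟩)))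
  have hdisj : ∀ m n, m < n → Disjoint (f m).2.1 (f n).2.1 := fun m n h => (hfr m n h).2
  have hmono : StrictMono fun n => (f n).1 := fun m n h => (hfr m n h).1
  obtain ⟨F', hF', hprod⟩ := hAd.norm_proj_mul_norm_proj_le hY hG (K := fun n => (f n).2.1)
    (fun n => (hfP n).1) (fun n => (hfP n).2.1)
    (orthonormal_of_proj_disjoint CX (fun n => (hfP n).1) hdisj
      (fun n => (hfP n).2.2.1.1) (fun n => (hfP n).2.2.1.2))
    (orthonormal_of_proj_disjoint CX (fun n => (hfP n).1) hdisj
      (fun n => (hfP n).2.2.2.1.1) (fun n => (hfP n).2.2.2.1.2))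
    (ContinuousLinearMap.id ℂ H₁) (fun n => (hfP n).2.2.1.2) (fun n => (hfP n).2.2.2.1.2)
    (ε := δ ^ 2) (by positivity)
  obtain ⟨k, hk⟩ := hF F' hF'
  obtain ⟨-, -, -, -, hB, hB', hBe, hBe', hBB⟩ := hfP k
  have h := hprod k _ hB' _ hB fun y hy x hx hyx =>
    hBB y hy x hx (hFmono hmono.le_apply (hk hyx))
  simp only [ContinuousLinearMap.id_apply] at h
  nlinarith

/-- The approximate relations of `U` are controlled. -/
theorem AdApproximable.approxRel_controlled (hAd : AdApproximable CX CY U)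
    (hY : 𝒴.coarse.IsCountablyGenerated) {δ : ℝ} (hδ : 0 < δ)
    {F : Set (Y × Y)} (hF : F ∈ 𝒴.coarse.entourages)
    {E : Set (X × X)} (hE : E ∈ 𝒳.coarse.entourages)
    {G : Set (X × X)} (hG : G ∈ 𝒳.coarse.entourages) :
    RelComp (approxRel 𝒳 𝒴 CX.proj CY.proj U δ F E)
      (RelComp G (RelTrans (approxRel 𝒳 𝒴 CX.proj CY.proj U δ F E))) ∈
        𝒴.coarse.entourages := by
  have hEGE : RelComp E (RelComp G E) ∈ 𝒳.coarse.entourages :=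
    𝒳.coarse.comp_mem hE (𝒳.coarse.comp_mem hG hE)
  obtain ⟨F', hF', h⟩ := hAd.exists_entourage_of_norm_proj_lt hY
    (𝒳.coarse.union_mem hE (𝒳.coarse.union_mem hEGE (𝒳.coarse.transpose_mem hEGE))) hδ
  refine 𝒴.coarse.mem_of_subset
    (𝒴.coarse.comp_mem hF (𝒴.coarse.comp_mem hF' hF)) ?_
  rintro ⟨y, y'⟩ ⟨x, ⟨_, ⟨B, A, rfl, hB, hBF, hA, hAE, hBA⟩, hy, hx⟩, x', hxx',
    ⟨_, ⟨B', A', rfl, hB', hBF', hA', hAE', hBA'⟩, hy', hx'⟩⟩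
  obtain ⟨e, he1, he2, he3⟩ := exists_unit_of_lt_norm_comp CX CY hA hδ hBA
  obtain ⟨e', he1', he2', he3'⟩ := exists_unit_of_lt_norm_comp CX CY hA' hδ hBA'
  have hAA := 𝒳.union_mem hA hA'
  have hsup : ∀ {D : Set X} {u : H₁}, D ∈ 𝒳.meas → D ⊆ A ∪ A' → CX.proj D u = u →
      CX.proj (A ∪ A') u = u := by
    intro D u hD hDA hu
    rw [← hu, CX.proj_proj_of_superset hAA hD hDA]
  obtain ⟨z, hz, z', hz', hzz⟩ := h (A ∪ A') hAA (by
    rintro ⟨a, b⟩ ⟨ha | ha, hb | hb⟩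
    · exact Or.inl (hAE ⟨ha, hb⟩)
    · exact Or.inr (Or.inl ⟨x, hAE ⟨ha, hx⟩, x', hxx', hAE' ⟨hx', hb⟩⟩)
    · exact Or.inr (Or.inr ⟨x, hAE ⟨hb, hx⟩, x', hxx', hAE' ⟨hx', ha⟩⟩)
    · exact Or.inl (hAE' ⟨ha, hb⟩)) e' e he1'
    (hsup hA' Set.subset_union_right he2') he1 (hsup hA Set.subset_union_left he2)
    B' hB' B hB he3' he3
  exact ⟨z, hBF ⟨hy, hz⟩, z', hzz, hBF' ⟨hz', hy'⟩⟩

end Rigidity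

theorem exists_signs_sum_norm_sq_le [NormedAddCommGroup H₁] [InnerProductSpace ℂ H₁] {ι : Type}
    (s : Finset ι) (x : ι → H₁) :
    ∃ b : ι → Bool, ∑ i ∈ s, ‖x i‖ ^ 2 ≤ ‖∑ i ∈ s, if b i = true then x i else -x i‖ ^ 2 := by
  classical
  induction s using Finset.induction_on with
  | empty => exact ⟨fun _ => true, by simp⟩
  | insert a s ha ih =>
    obtain ⟨b, hb⟩ := ih
    set S := ∑ i ∈ s, if b i = true then x i else -x i with hS
    have hupd : ∀ c, (∑ i ∈ s, if Function.update b a c i = true then x i else -x i) = S := by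
      intro c
      refine Finset.sum_congr rfl fun i hi => ?_
      rw [Function.update_of_ne (ne_of_mem_of_not_mem hi ha)]
    have hpar := parallelogram_law_with_norm ℂ (x a) S
    rw [Finset.sum_insert ha]
    by_cases h : ‖x a‖ ^ 2 + ‖S‖ ^ 2 ≤ ‖x a + S‖ ^ 2
    · refine ⟨Function.update b a true, ?_⟩
      rw [Finset.sum_insert ha, hupd]
      simp only [Function.update_self, if_true]
      linarith
    · refine ⟨Function.update b a false, ?_⟩
      rw [Finset.sum_insert ha, hupd]
      simp only [Function.update_self, Bool.false_eq_true, if_false]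
      rw [neg_add_eq_sub, norm_sub_rev]
      nlinarith

section Concentration

open CoarseSpace

variable [NormedAddCommGroup H₁] [InnerProductSpace ℂ H₁] [CompleteSpace H₁]
variable [NormedAddCommGroup H₂] [InnerProductSpace ℂ H₂] [CompleteSpace H₂]
variable {𝒳 : LFCMSpace X} {𝒴 : LFCMSpace Y}
variable {CX : CoarseModule 𝒳 H₁} {CY : CoarseModule 𝒴 H₂} {U : H₁ →L[ℂ] H₂}

/-- The union of the blocks selected by `b`. -/
def LFCMSpace.blockUnion (𝒳 : LFCMSpace X) (b : 𝒳.partition → Bool) : Set X :=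
  ⋃₀ (Subtype.val '' {P | b P = true})

theorem LFCMSpace.blockUnion_meas (b : 𝒳.partition → Bool) : 𝒳.blockUnion b ∈ 𝒳.meas := by
  refine LFCMSpace.sUnion_meas ?_
  rintro _ ⟨P, -, rfl⟩
  exact P.2

namespace CoarseModule

variable (M : CoarseModule 𝒳 H₁)

theorem hasSum_proj_blockUnion (b : 𝒳.partition → Bool) (x : H₁) :
    HasSum (fun P => if b P = true then M.proj P x else 0) (M.proj (𝒳.blockUnion b) x) := by
  convert M.hasSum_proj_partition (M.proj (𝒳.blockUnion b) x) using 2 with P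
  have hP := LFCMSpace.meas_of_mem_partition P.2
  split_ifs with h
  · exact (M.proj_proj_of_subset hP (LFCMSpace.blockUnion_meas b)
      (Set.subset_sUnion_of_mem ⟨P, h, rfl⟩) x).symm
  · refine (M.proj_proj_of_disjoint hP (LFCMSpace.blockUnion_meas b) ?_ x).symm
    refine Set.disjoint_left.2 ?_
    rintro y hy ⟨_, ⟨Q, hQ, rfl⟩, hyQ⟩
    rw [Subtype.ext (LFCMSpace.eq_of_mem_partition P.2 Q.2 hy hyQ)] at h
    exact h hQ

theorem approximable_proj {A : Set X} (hA : A ∈ 𝒳.meas) :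
    Approximable 𝒳 M.proj M.proj (M.proj A) := by
  refine fun ε hε => ⟨M.proj A, ?_, by simpa using hε.le⟩
  refine 𝒳.coarse.mem_of_subset (𝒳.coarse.comp_mem 𝒳.disc_mem 𝒳.disc_mem) ?_
  rintro ⟨y, x⟩ ⟨_, ⟨D, D', rfl, hD, hDd, hD', hDd', hne⟩, hy, hx⟩
  have hDD : (D ∩ (A ∩ D')).Nonempty := by
    by_contra h
    rw [Set.not_nonempty_iff_eq_empty] at h
    refine hne ?_
    rw [← M.proj_inter hA hD', ← M.proj_inter hD (LFCMSpace.inter_mem hA hD'), h, M.proj_empty]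
  obtain ⟨z, hzD, -, hzD'⟩ := hDD
  exact ⟨z, hDd ⟨hy, hzD⟩, hDd' ⟨hzD', hx⟩⟩

theorem hasSum_norm_sq_proj_partition (x : H₁) :
    HasSum (fun P : 𝒳.partition => ‖M.proj P x‖ ^ 2) (‖x‖ ^ 2) := by
  have h := (M.hasSum_proj_partition x).mapL (innerSL ℂ x)
  simp only [innerSL_apply_apply] at h
  have h1 : ∀ P : 𝒳.partition, inner ℂ x (M.proj P x) = ((‖M.proj P x‖ ^ 2 : ℝ) : ℂ) := by
    intro P
    rw [M.inner_proj_self (LFCMSpace.meas_of_mem_partition P.2)]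
    push_cast
    rfl
  have h2 : inner ℂ x x = ((‖x‖ ^ 2 : ℝ) : ℂ) := by
    rw [inner_self_eq_norm_sq_to_K]
    push_cast
    rfl
  simp only [h1, h2] at h
  exact Complex.hasSum_ofReal.1 h

end CoarseModule

theorem norm_proj_comp_adjoint (CX : CoarseModule 𝒳 H₁) (CY : CoarseModule 𝒴 H₂)
    (U : H₁ →L[ℂ] H₂) {A : Set X} (hA : A ∈ 𝒳.meas) {B : Set Y} (hB : B ∈ 𝒴.meas) :
    ‖CX.proj A ∘L ContinuousLinearMap.adjoint U ∘L CY.proj B‖ =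
      ‖CY.proj B ∘L U ∘L CX.proj A‖ := by
  rw [← LinearIsometryEquiv.norm_map ContinuousLinearMap.adjoint (CY.proj B ∘L U ∘L CX.proj A),
    ContinuousLinearMap.adjoint_comp, ContinuousLinearMap.adjoint_comp, CX.adjoint_proj hA,
    CY.adjoint_proj hB, ContinuousLinearMap.comp_assoc]

theorem IsUnitaryOp.norm_apply (hU : IsUnitaryOp U) (x : H₁) : ‖U x‖ = ‖x‖ := by
  have h : ContinuousLinearMap.adjoint U (U x) = x := DFunLike.congr_fun hU.1 x
  have h1 : inner ℂ (U x) (U x) = inner ℂ x x := by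
    rw [← ContinuousLinearMap.adjoint_inner_left, h]
  rw [@norm_eq_sqrt_re_inner ℂ, @norm_eq_sqrt_re_inner ℂ, h1]

theorem IsUnitaryOp.adjoint (hU : IsUnitaryOp U) :
    IsUnitaryOp (ContinuousLinearMap.adjoint U) := by
  refine ⟨?_, ?_⟩
  · rw [ContinuousLinearMap.adjoint_adjoint]; exact hU.2
  · rw [ContinuousLinearMap.adjoint_adjoint]; exact hU.1

/-- The uniformly local cutoffs `U† 1_C U`, with `C` a union of blocks. -/
theorem AdApproximable.exists_quasiLocal_blockUnion
    (hAd : AdApproximable CY CX (ContinuousLinearMap.adjoint U))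
    (hX : 𝒳.coarse.IsCountablyGenerated) {ε : ℝ} (hε : 0 < ε) :
    ∃ E ∈ 𝒳.coarse.entourages, ∀ b,
      QuasiLocal CX E ε (ContinuousLinearMap.adjoint U ∘L CY.proj (𝒴.blockUnion b) ∘L U) := by
  have hw : WeaklyAdditive fun b => CY.proj (𝒴.blockUnion b) := by
    intro x y
    have hsum := (CY.hasSum_proj_partition x).mapL (innerSL ℂ y)
    refine ⟨fun P => inner ℂ y (CY.proj P x), hsum.summable, fun b => ?_⟩
    have h := (CY.hasSum_proj_blockUnion b x).mapL (innerSL ℂ y)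
    rw [innerSL_apply_apply] at h
    rw [← h.tsum_eq]
    refine tsum_congr fun P => ?_
    split_ifs <;> simp
  refine WeaklyAdditive.exists_quasiLocal ?_ hX ?_ hε
  · have := hw.conj (ContinuousLinearMap.adjoint U)
    rwa [ContinuousLinearMap.adjoint_adjoint] at this
  · intro b
    have := hAd _ (CY.approximable_proj (LFCMSpace.blockUnion_meas b))
    rwa [ContinuousLinearMap.adjoint_adjoint] at this

/-- Every block carrying a nonzero vector has a neighbourhood of uniformly bounded size on
which `U` has a matrix coefficient of norm greater than `δ`. -/
theorem AdApproximable.exists_lt_norm_comp (hU : IsUnitaryOp U)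
    (hAd : AdApproximable CY CX (ContinuousLinearMap.adjoint U))
    (hX : 𝒳.coarse.IsCountablyGenerated) {δ : ℝ} (hδ₀ : 0 < δ) (hδ₁ : δ < 1) :
    ∃ E ∈ 𝒳.coarse.entourages, ∀ P ∈ 𝒳.partition, CX.proj P ≠ 0 →
      ∃ P' ∈ 𝒳.meas, P ⊆ P' ∧ P' ×ˢ P' ⊆ E ∧
        ∃ Q ∈ 𝒴.partition, δ < ‖CY.proj Q ∘L U ∘L CX.proj P'‖ := by
  classical
  have hδ2 : 0 < 1 - δ ^ 2 := by nlinarith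
  obtain ⟨E, hE, hql⟩ := hAd.exists_quasiLocal_blockUnion hX (ε := (1 - δ ^ 2) / 4)
    (by positivity)
  have hE' := 𝒳.coarse.union_mem hE 𝒳.coarse.diagonal_mem
  refine ⟨_, nbhd_conj_mem 𝒳.disc_mem (nbhd_conj_mem hE' 𝒳.disc_mem), fun P hP hP0 => ?_⟩
  set P' := nbhd 𝒳.disc (nbhd (E ∪ {p : X × X | p.1 = p.2}) P) with hP'
  have hP'm : P' ∈ 𝒳.meas := LFCMSpace.nbhd_disc_meas _
  have hPm := LFCMSpace.meas_of_mem_partition hP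
  refine ⟨P', hP'm, ?_, nbhd_prod_subset (nbhd_prod_subset (LFCMSpace.prod_subset_disc hP)), ?_⟩
  · exact fun x hx => LFCMSpace.subset_nbhd_disc _ ⟨x, hx, Or.inr rfl⟩
  by_contra! hcon
  obtain ⟨v₀, hv₀⟩ : ∃ v₀, CX.proj P v₀ ≠ 0 := by
    by_contra! h
    exact hP0 (ContinuousLinearMap.ext h)
  obtain ⟨v, hv1, hv2, -⟩ := exists_unit_of_proj_ne_zero CX hPm hv₀
  set w := U v with hw
  have hw1 : ‖w‖ = 1 := by rw [hw, hU.norm_apply, hv1]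
  have hcut : ∀ b, ‖CX.proj P'ᶜ (ContinuousLinearMap.adjoint U
      (CY.proj (𝒴.blockUnion b) w))‖ ≤ (1 - δ ^ 2) / 4 := by
    intro b
    have h := (hql b).norm_proj_le (𝒳.compl_mem hP'm) hPm (fun y hy x hx hyx =>
      hy (LFCMSpace.subset_nbhd_disc _ ⟨x, hx, Or.inl hyx⟩)) v
    rw [hv2, hv1, mul_one] at h
    exact h
  obtain ⟨J, hJ⟩ := ((CY.hasSum_norm_sq_proj_partition w).eventually
    (lt_mem_nhds (show (1 / 2 : ℝ) < ‖w‖ ^ 2 by rw [hw1]; norm_num))).exists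
  let L : H₂ →L[ℂ] H₁ := CX.proj P'ᶜ ∘L ContinuousLinearMap.adjoint U
  obtain ⟨b, hb⟩ := exists_signs_sum_norm_sq_le J fun Q : 𝒴.partition => L (CY.proj Q w)
  have hfin : ∀ c : 𝒴.partition → Bool, (∀ Q, c Q = true → Q ∈ J) →
      CY.proj (𝒴.blockUnion c) w = ∑ Q ∈ J, if c Q = true then CY.proj Q w else 0 := by
    intro c hc
    refine (CY.hasSum_proj_blockUnion c w).unique (hasSum_sum_of_ne_finset_zero ?_)
    intro Q hQ
    rw [if_neg fun h => hQ (hc Q h)]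
  have hsigned : (∑ Q ∈ J, if b Q = true then L (CY.proj Q w) else -L (CY.proj Q w)) =
      L (CY.proj (𝒴.blockUnion fun Q => decide (Q ∈ J) && b Q) w) -
        L (CY.proj (𝒴.blockUnion fun Q => decide (Q ∈ J) && !b Q) w) := by
    rw [hfin _ (by simp +contextual), hfin _ (by simp +contextual), map_sum, map_sum, ← Finset.sum_sub_distrib]
    refine Finset.sum_congr rfl fun Q hQ => ?_
    cases h : b Q <;> simp [hQ]
  have hup : ‖∑ Q ∈ J, if b Q = true then L (CY.proj Q w) else -L (CY.proj Q w)‖ ≤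
      (1 - δ ^ 2) / 2 := by
    rw [hsigned]
    refine (norm_sub_le _ _).trans ?_
    have h1 := hcut fun Q => decide (Q ∈ J) && b Q
    have h2 := hcut fun Q => decide (Q ∈ J) && !b Q
    simp only [L, ContinuousLinearMap.comp_apply]
    linarith
  have hlow : ∀ Q ∈ J, (1 - δ ^ 2) * ‖CY.proj Q w‖ ^ 2 ≤ ‖L (CY.proj Q w)‖ ^ 2 := by
    intro Q _
    have hQm := LFCMSpace.meas_of_mem_partition Q.2
    have h1 := CX.norm_sq_proj_add hP'm (ContinuousLinearMap.adjoint U (CY.proj Q w))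
    rw [hU.adjoint.norm_apply] at h1
    have h2 := (CX.proj P' ∘L ContinuousLinearMap.adjoint U ∘L CY.proj Q).le_of_opNorm_le
      ((norm_proj_comp_adjoint CX CY U hP'm hQm).trans_le (hcon Q Q.2)) (CY.proj Q w)
    simp only [ContinuousLinearMap.comp_apply] at h2
    rw [CY.proj_proj_of_subset hQm hQm subset_rfl] at h2
    have h3 : ‖CX.proj P' (ContinuousLinearMap.adjoint U (CY.proj Q w))‖ ^ 2 ≤
        (δ * ‖CY.proj Q w‖) ^ 2 := by gcongr
    simp only [L, ContinuousLinearMap.comp_apply]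
    nlinarith
  have h1 := Finset.sum_le_sum hlow
  rw [← Finset.mul_sum] at h1
  have h2 : (1 - δ ^ 2) * (1 / 2) <
      (1 - δ ^ 2) * ∑ Q ∈ J, ‖CY.proj Q w‖ ^ 2 := mul_lt_mul_of_pos_left hJ hδ2
  have h3 := pow_le_pow_left₀ (norm_nonneg _) hup 2
  nlinarith [sq_nonneg δ]

end Concentration

section Equivalence

open CoarseSpace

theorem RelAsymp.of_asymptotic {C : CoarseSpace X} {R : Set (Y × X)} {D : Set X}
    (hR : RelComp (RelTrans R) R ∈ C.entourages) (hD : C.Asymptotic (Prod.snd '' R) D) :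
    RelAsymp C C (RelComp (RelTrans R) R) {p : X × X | p.1 = p.2 ∧ p.1 ∈ D} := by
  obtain ⟨⟨E, hE, hRE⟩, E', hE', hDE⟩ := hD
  refine ⟨⟨_, C.comp_mem hR hE, E, hE, ?_⟩, E', hE', E', hE', ?_⟩
  · rintro ⟨x, x'⟩ ⟨y, hx, hx'⟩
    obtain ⟨d, hd, hxd⟩ := hRE ⟨(y, x'), hx', rfl⟩
    exact ⟨(d, d), ⟨rfl, hd⟩, ⟨x', ⟨y, hx, hx'⟩, hxd⟩, hxd⟩
  · rintro ⟨d, d'⟩ ⟨h, hd⟩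
    obtain rfl : d = d' := h
    obtain ⟨_, ⟨⟨y, x⟩, hyx, rfl⟩, hdx⟩ := hDE hd
    exact ⟨(x, x), ⟨y, hyx, hyx⟩, hdx, hdx⟩

theorem RelComp.diagonal_left (R : Set (Y × X)) : RelComp {p : Y × Y | p.1 = p.2} R = R := by
  ext ⟨y, x⟩
  constructor
  · rintro ⟨z, h, hz⟩
    obtain rfl : y = z := h
    exact hz
  · exact fun h => ⟨y, rfl, h⟩

variable [NormedAddCommGroup H₁] [InnerProductSpace ℂ H₁] [CompleteSpace H₁]
variable [NormedAddCommGroup H₂] [InnerProductSpace ℂ H₂] [CompleteSpace H₂]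
variable {𝒳 : LFCMSpace X} {𝒴 : LFCMSpace Y}
variable {CX : CoarseModule 𝒳 H₁} {CY : CoarseModule 𝒴 H₂} {U : H₁ →L[ℂ] H₂}

theorem relTrans_approxRel (CX : CoarseModule 𝒳 H₁) (CY : CoarseModule 𝒴 H₂) (U : H₁ →L[ℂ] H₂)
    (δ : ℝ) (F : Set (Y × Y)) (E : Set (X × X)) :
    RelTrans (approxRel 𝒳 𝒴 CX.proj CY.proj U δ F E) =
      approxRel 𝒴 𝒳 CY.proj CX.proj (ContinuousLinearMap.adjoint U) δ E F := by
  ext ⟨x, y⟩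
  constructor
  · rintro ⟨_, ⟨B, A, rfl, hB, hBF, hA, hAE, h⟩, hy, hx⟩
    refine ⟨_, ⟨A, B, rfl, hA, hAE, hB, hBF, ?_⟩, hx, hy⟩
    rwa [norm_proj_comp_adjoint CX CY U hA hB]
  · rintro ⟨_, ⟨A, B, rfl, hA, hAE, hB, hBF, h⟩, hx, hy⟩
    refine ⟨_, ⟨B, A, rfl, hB, hBF, hA, hAE, ?_⟩, hy, hx⟩
    rwa [norm_proj_comp_adjoint CX CY U hA hB] at h

/-- The approximate relation of a unitary is densely defined on the faithfulness domain. -/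
theorem AdApproximable.asymptotic_snd_approxRel (hU : IsUnitaryOp U)
    (hAd : AdApproximable CY CX (ContinuousLinearMap.adjoint U))
    (hX : 𝒳.coarse.IsCountablyGenerated) {δ : ℝ} (hδ₀ : 0 < δ) (hδ₁ : δ < 1) :
    ∃ E₀ ∈ 𝒳.coarse.entourages, ∀ F, 𝒴.disc ⊆ F → ∀ E ∈ 𝒳.coarse.entourages, E₀ ⊆ E →
      𝒳.coarse.Asymptotic (Prod.snd '' approxRel 𝒳 𝒴 CX.proj CY.proj U δ F E)
        (domKappa 𝒳 CX 1) := by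
  obtain ⟨E₀, hE₀, h⟩ := hAd.exists_lt_norm_comp hU hX hδ₀ hδ₁
  refine ⟨E₀, hE₀, fun F hF E hE hEE => ⟨⟨E, hE, ?_⟩, _, 𝒳.coarse.diagonal_mem, ?_⟩⟩
  · rintro _ ⟨⟨y, x⟩, ⟨_, ⟨B, A, rfl, hB, hBF, hA, hAE, hBA⟩, hy, hx⟩, rfl⟩
    obtain ⟨e, he1, he2, -⟩ := exists_unit_of_lt_norm_comp CX CY hA hδ₀ hBA
    have he0 : CX.proj A e ≠ 0 := by
      rw [he2, ← norm_pos_iff, he1]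
      exact one_pos
    obtain ⟨P, hP, hPA⟩ := CX.exists_proj_inter_ne_zero hA he0
    have hne : CX.proj (P ∩ A) ≠ 0 := fun h0 => hPA (by rw [h0]; rfl)
    obtain ⟨z, hzP, hzA⟩ : (P ∩ A).Nonempty := by
      by_contra hemp
      rw [Set.not_nonempty_iff_eq_empty] at hemp
      exact hne (by rw [hemp, CX.proj_empty])
    refine ⟨z, ⟨P ∩ A, ⟨LFCMSpace.inter_mem (LFCMSpace.meas_of_mem_partition hP) hA, ?_,
      (one_le_projRank_iff _).2 hne⟩, hzP, hzA⟩, hAE ⟨hx, hzA⟩⟩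
    exact fun p hp => LFCMSpace.prod_subset_disc hP ⟨hp.1.1, hp.2.1⟩
  · rintro x ⟨A, ⟨hA, hAd, hA1⟩, hxA⟩
    have hA0 := (one_le_projRank_iff _).1 hA1
    obtain ⟨P, hP, hxP⟩ := 𝒳.exists_mem_partition x
    have hAP : A ⊆ P := fun z hz => LFCMSpace.mem_of_disc hP (hAd ⟨hz, hxA⟩) hxP
    have hP0 : CX.proj P ≠ 0 := by
      intro h0
      refine hA0 (ContinuousLinearMap.ext fun v => ?_)
      rw [← CX.proj_proj_of_subset hA (LFCMSpace.meas_of_mem_partition hP) hAP, h0]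
      simp
    obtain ⟨P', hP', hPP', hP'E, Q, hQ, hδQ⟩ := h P hP hP0
    obtain ⟨y, hy⟩ := 𝒴.isPartition.nonempty Q hQ
    exact ⟨x, ⟨(y, x), ⟨_, ⟨Q, P', rfl, LFCMSpace.meas_of_mem_partition hQ,
      (LFCMSpace.prod_subset_disc hQ).trans hF, hP', hP'E.trans hEE, hδQ⟩, hy, hPP' hxP⟩,
      rfl⟩, rfl⟩

end Equivalence

/-- Non-faithful rigidity: a unitary intertwining the algebras of
approximable operators induces, for every `δ ∈ (0,1)` and all sufficiently large entourages,
a coarse equivalence between the faithfulness domains, with coarse inverse the approximate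
relation of the adjoint. -/
theorem nonfaithful_rigidity {X Y : Type} {H₁ H₂ : Type}
    [NormedAddCommGroup H₁] [InnerProductSpace ℂ H₁] [CompleteSpace H₁]
    [NormedAddCommGroup H₂] [InnerProductSpace ℂ H₂] [CompleteSpace H₂]
    (𝒳 : LFCMSpace X) (𝒴 : LFCMSpace Y)
    (hX : 𝒳.coarse.IsCountablyGenerated) (hY : 𝒴.coarse.IsCountablyGenerated)
    (CX : CoarseModule 𝒳 H₁) (CY : CoarseModule 𝒴 H₂)
    (U : H₁ →L[ℂ] H₂) (hU : IsUnitaryOp U)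
    (hAd : ∀ t : H₁ →L[ℂ] H₁, Approximable 𝒳 CX.proj CX.proj t →
      Approximable 𝒴 CY.proj CY.proj (U ∘L t ∘L ContinuousLinearMap.adjoint U))
    (hAd' : ∀ s : H₂ →L[ℂ] H₂, Approximable 𝒴 CY.proj CY.proj s →
      Approximable 𝒳 CX.proj CX.proj (ContinuousLinearMap.adjoint U ∘L s ∘L U))
    (δ : ℝ) (hδ₀ : 0 < δ) (hδ₁ : δ < 1) :
    ∃ F₀ ∈ 𝒴.coarse.entourages, ∃ E₀ ∈ 𝒳.coarse.entourages,
      ∀ F ∈ 𝒴.coarse.entourages, F₀ ⊆ F → ∀ E ∈ 𝒳.coarse.entourages, E₀ ⊆ E →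
        IsRelCoarseEquivOn 𝒳.coarse 𝒴.coarse (domKappa 𝒳 CX 1) (domKappa 𝒴 CY 1)
          (approxRel 𝒳 𝒴 CX.proj CY.proj U δ F E) ∧
        IsRelCoarseInverseOn 𝒳.coarse 𝒴.coarse (domKappa 𝒳 CX 1) (domKappa 𝒴 CY 1)
          (approxRel 𝒳 𝒴 CX.proj CY.proj U δ F E)
          (approxRel 𝒴 𝒳 CY.proj CX.proj (ContinuousLinearMap.adjoint U) δ E F) := by
  have hAdX : AdApproximable CX CY U := hAd
  have hAdY : AdApproximable CY CX (ContinuousLinearMap.adjoint U) := by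
    intro s hs
    rw [ContinuousLinearMap.adjoint_adjoint]
    exact hAd' s hs
  obtain ⟨E₁, hE₁, hdom⟩ := hAdY.asymptotic_snd_approxRel hU hX hδ₀ hδ₁
  obtain ⟨F₁, hF₁, hsurj⟩ := AdApproximable.asymptotic_snd_approxRel (CX := CY) (CY := CX)
    hU.adjoint (by rwa [ContinuousLinearMap.adjoint_adjoint]) hY hδ₀ hδ₁
  refine ⟨𝒴.disc ∪ F₁, 𝒴.coarse.union_mem 𝒴.disc_mem hF₁, 𝒳.disc ∪ E₁,
    𝒳.coarse.union_mem 𝒳.disc_mem hE₁, fun F hF hFF E hE hEE => ?_⟩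
  have hD := hdom F (Set.subset_union_left.trans hFF) E hE (Set.subset_union_right.trans hEE)
  have hS := hsurj E (Set.subset_union_left.trans hEE) F hF (Set.subset_union_right.trans hFF)
  have hcX : ∀ G ∈ 𝒳.coarse.entourages, _ :=
    fun G hG => hAdX.approxRel_controlled hY hδ₀ hF hE hG
  have hcY : ∀ G ∈ 𝒴.coarse.entourages, _ :=
    fun G hG => hAdY.approxRel_controlled hX hδ₀ hE hF hG
  rw [← relTrans_approxRel] at hS hcY ⊢
  set R := approxRel 𝒳 𝒴 CX.proj CY.proj U δ F E
  have hfst : Prod.snd '' RelTrans R = Prod.fst '' R := by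
    ext y
    constructor
    · rintro ⟨⟨x, y⟩, h, rfl⟩
      exact ⟨(y, x), h, rfl⟩
    · rintro ⟨⟨y, x⟩, h, rfl⟩
      exact ⟨(x, y), h, rfl⟩
  have hXd := hcY _ 𝒴.coarse.diagonal_mem
  have hYd := hcX _ 𝒳.coarse.diagonal_mem
  rw [RelComp.diagonal_left] at hXd hYd
  exact ⟨⟨hcX, hcY, hD, hfst ▸ hS⟩, RelAsymp.of_asymptotic hXd hD,
    RelAsymp.of_asymptotic (R := RelTrans R) hYd hS⟩
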